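/- arXiv:2206.07455 — 15 statements merged into one kernel-verified Lean document; each statement's English description precedes it below -/
import Mathlib

section
/- For every t₃ ∈ [0,1], every n ∈ ℕ, and every t₂ ∈ [0,1], one has ∫₀¹ 𝟙_{𝒫_{t₃}}(t₂,t₁) · √2·sin((n+1)·π·t₁) dt₁ = (2/((n+1)·π)) · sin((n+1)·π·t₃) · √2·sin((n+1)·π·t₂). In other words, the functions u_n(t) = √2·sin((n+1)πt) are a common eigenbasis of the integral operators N_{t₃} with kernel 𝟙_{𝒫_{t₃}}, with eigenvalues (2/((n+1)π))·sin((n+1)πt₃). -/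
open MeasureTheory Real

/-- `u n t = √2 · sin((n+1)·π·t)`. -/
noncomputable def u (n : ℕ) (t : ℝ) : ℝ := Real.sqrt 2 * Real.sin (((n : ℝ) + 1) * Real.pi * t)

/-- The slice `𝒫_s ⊆ ℝ²`: pairs `(t₂, t₁) ∈ [0,1]²` with `s ≤ t₁+t₂ ≤ 2−s` and `|t₁−t₂| ≤ s`. -/
def Pslice (s : ℝ) : Set (ℝ × ℝ) :=
  {p | p.1 ∈ Set.Icc (0:ℝ) 1 ∧ p.2 ∈ Set.Icc (0:ℝ) 1 ∧
       s ≤ p.1 + p.2 ∧ p.1 + p.2 ≤ 2 - s ∧ |p.1 - p.2| ≤ s}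

theorem eigenbasis_of_slice_kernel
    (t₃ : ℝ) (ht₃ : t₃ ∈ Set.Icc (0:ℝ) 1) (n : ℕ) (t₂ : ℝ) (ht₂ : t₂ ∈ Set.Icc (0:ℝ) 1) :
    ∫ t₁ in (0:ℝ)..1, (Pslice t₃).indicator 1 (t₂, t₁) * u n t₁
      = (2 / (((n : ℝ) + 1) * π)) * Real.sin (((n : ℝ) + 1) * π * t₃) * u n t₂ := by
  obtain ⟨h30, h31⟩ := ht₃
  obtain ⟨h20, h21⟩ := ht₂
  have hk : ((n : ℝ) + 1) * π ≠ 0 := by positivity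
  have hab : |t₂ - t₃| ≤ min (t₂ + t₃) (2 - t₃ - t₂) := by
    rw [abs_le]
    rcases min_choice (t₂ + t₃) (2 - t₃ - t₂) with h | h <;> rw [h] <;> constructor <;> linarith
  have hfun : (fun t₁ : ℝ => (Pslice t₃).indicator (1 : ℝ × ℝ → ℝ) (t₂, t₁) * u n t₁)
      = (Set.Icc |t₂ - t₃| (min (t₂ + t₃) (2 - t₃ - t₂))).indicator (u n) := by
    funext t
    have hiff : (t₂, t) ∈ Pslice t₃ ↔
        t ∈ Set.Icc |t₂ - t₃| (min (t₂ + t₃) (2 - t₃ - t₂)) := by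
      simp only [Pslice, Set.mem_setOf_eq, Set.mem_Icc, le_min_iff, abs_le]
      constructor
      · rintro ⟨_, ⟨_, _⟩, _, _, _, _⟩
        refine ⟨⟨?_, ?_⟩, ?_, ?_⟩ <;> linarith
      · rintro ⟨⟨_, _⟩, _, _⟩
        refine ⟨⟨?_, ?_⟩, ⟨?_, ?_⟩, ?_, ?_, ?_, ?_⟩ <;> linarith
    by_cases h : (t₂, t) ∈ Pslice t₃
    · rw [Set.indicator_of_mem h, Set.indicator_of_mem (hiff.1 h)]; simp
    · rw [Set.indicator_of_notMem h, Set.indicator_of_notMem (fun h' => h (hiff.2 h'))]; simp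
  have hsub : Set.Icc (0:ℝ) 1 ∩ Set.Icc |t₂ - t₃| (min (t₂ + t₃) (2 - t₃ - t₂))
      = Set.Icc |t₂ - t₃| (min (t₂ + t₃) (2 - t₃ - t₂)) := by
    apply Set.inter_eq_right.2
    apply Set.Icc_subset_Icc (abs_nonneg _)
    rcases le_total (t₂ + t₃) 1 with h | h
    · exact (min_le_left _ _).trans h
    · exact (min_le_right _ _).trans (by linarith)
  have hcb : Real.cos (((n : ℝ) + 1) * π * min (t₂ + t₃) (2 - t₃ - t₂))
      = Real.cos (((n : ℝ) + 1) * π * (t₂ + t₃)) := by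
    rcases min_choice (t₂ + t₃) (2 - t₃ - t₂) with h | h <;> rw [h]
    have := Real.cos_nat_mul_two_pi_sub (((n : ℝ) + 1) * π * (t₂ + t₃)) (n + 1)
    rw [← this]
    push_cast
    congr 1
    ring
  have hca : Real.cos (((n : ℝ) + 1) * π * |t₂ - t₃|)
      = Real.cos (((n : ℝ) + 1) * π * (t₂ - t₃)) := by
    rcases abs_choice (t₂ - t₃) with h | h <;> rw [h]
    rw [mul_neg, Real.cos_neg]
  rw [hfun, intervalIntegral.integral_of_le zero_le_one, ← integral_Icc_eq_integral_Ioc,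
    setIntegral_indicator measurableSet_Icc, hsub, integral_Icc_eq_integral_Ioc,
    ← intervalIntegral.integral_of_le hab]
  unfold u
  rw [intervalIntegral.integral_const_mul,
    intervalIntegral.integral_comp_mul_left (fun x => Real.sin x) hk, integral_sin, hca, hcb,
    mul_sub (((n : ℝ) + 1) * π), mul_add (((n : ℝ) + 1) * π), Real.cos_sub, Real.cos_add,
    smul_eq_mul]
  field_simp
  ring
end

section
/- The series Σ_{n=0}^∞ (√2/((n+1)·π)) · u_n(t₁)·u_n(t₂)·u_n(t₃), i.e. the sequence of partial sums S_N(t₁,t₂,t₃) = Σ_{n=0}^N (√2/((n+1)π))·u_n(t₁)u_n(t₂)u_n(t₃), converges in L²([0,1]³) to the indicator function 𝟙_𝒫 of the trinion polytope 𝒫. -/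
open MeasureTheory Real Filter

/-- The trinion polytope `𝒫 ⊆ ℝ³`: triples `(t₁,t₂,t₃)` with `0 ≤ tᵢ ≤ 1`,
`t₁+t₂+t₃ ≤ 2` and `|t₂−t₃| ≤ t₁ ≤ t₂+t₃`. -/
def trinion : Set (ℝ × ℝ × ℝ) :=
  {p | p.1 ∈ Set.Icc (0:ℝ) 1 ∧ p.2.1 ∈ Set.Icc (0:ℝ) 1 ∧ p.2.2 ∈ Set.Icc (0:ℝ) 1 ∧
       p.1 + p.2.1 + p.2.2 ≤ 2 ∧ |p.2.1 - p.2.2| ≤ p.1 ∧ p.1 ≤ p.2.1 + p.2.2}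

theorem u_cont (n : ℕ) : Continuous (u n) := by unfold u; fun_prop

theorem int_cos_aux (j : ℤ) (hj : j ≠ 0) : ∫ t in (0:ℝ)..1, Real.cos ((j * π) * t) = 0 := by
  have h : (j : ℝ) * π ≠ 0 := mul_ne_zero (by exact_mod_cast hj) Real.pi_ne_zero
  rw [intervalIntegral.integral_comp_mul_left (fun x => Real.cos x) h]
  simp [Real.sin_int_mul_pi]

theorem u_orth (n m : ℕ) : ∫ t in (0:ℝ)..1, u n t * u m t = if n = m then 1 else 0 := by
  have e : ∀ t : ℝ, u n t * u m t = Real.cos ((((n:ℤ) - (m:ℤ) : ℤ) * π) * t)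
      - Real.cos ((((n:ℤ) + (m:ℤ) + 2 : ℤ) * π) * t) := by
    intro t
    have h2 : Real.sqrt 2 * Real.sqrt 2 = 2 := Real.mul_self_sqrt (by norm_num)
    have a1 : (((n:ℤ) - (m:ℤ) : ℤ) * π) * t = ((n:ℝ)+1) * π * t - ((m:ℝ)+1) * π * t := by
      push_cast; ring
    have a2 : (((n:ℤ) + (m:ℤ) + 2 : ℤ) * π) * t = ((n:ℝ)+1) * π * t + ((m:ℝ)+1) * π * t := by
      push_cast; ring
    rw [a1, a2, Real.cos_sub, Real.cos_add]
    unfold u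
    linear_combination (Real.sin (((n:ℝ)+1) * π * t) * Real.sin (((m:ℝ)+1) * π * t)) * h2
  simp_rw [e]
  rw [intervalIntegral.integral_sub (Continuous.intervalIntegrable (by fun_prop) _ _)
    (Continuous.intervalIntegrable (by fun_prop) _ _), int_cos_aux ((n:ℤ) + (m:ℤ) + 2) (by omega)]
  split_ifs with h
  · subst h; simp
  · rw [int_cos_aux _ (by omega)]; simp

theorem int_ind (lo hi : ℝ) (h0 : 0 ≤ lo) (h : lo ≤ hi) (h1 : hi ≤ 1) (g : ℝ → ℝ) :
    ∫ t in (0:ℝ)..1, (Set.Icc lo hi).indicator g t = ∫ t in lo..hi, g t := by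
  rw [intervalIntegral.integral_of_le (by norm_num), intervalIntegral.integral_of_le h,
    ← integral_Icc_eq_integral_Ioc, ← integral_Icc_eq_integral_Ioc,
    setIntegral_indicator measurableSet_Icc,
    Set.inter_eq_right.2 (Set.Icc_subset_Icc h0 h1)]

noncomputable def cc (n : ℕ) : ℝ := Real.sqrt 2 / (((n : ℝ) + 1) * π)

theorem int_u (n : ℕ) (s t : ℝ) :
    ∫ x in |s - t|..(1 - |1 - s - t|), u n x = cc n * u n s * u n t := by
  have h : ((n:ℝ) + 1) * π ≠ 0 := by positivity
  have e : ∀ x, u n x = Real.sqrt 2 * Real.sin ((((n:ℝ) + 1) * π) * x) := fun x => rfl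
  simp_rw [e]
  rw [intervalIntegral.integral_const_mul,
    intervalIntegral.integral_comp_mul_left (fun x => Real.sin x) h, integral_sin]
  have c1 : Real.cos (((n:ℝ) + 1) * π * |s - t|)
      = Real.cos (((n:ℝ) + 1) * π * s - ((n:ℝ) + 1) * π * t) := by
    rw [← mul_sub, ← Real.cos_abs (((n:ℝ) + 1) * π * (s - t)), abs_mul,
      abs_of_pos (show 0 < ((n:ℝ) + 1) * π by positivity)]
  have c2 : Real.cos (((n:ℝ) + 1) * π * (1 - |1 - s - t|))
      = Real.cos (((n:ℝ) + 1) * π * s + ((n:ℝ) + 1) * π * t) := by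
    rcases abs_cases (1 - s - t) with ⟨h, _⟩ | ⟨h, _⟩
    · rw [h]; congr 1; ring
    · rw [h, ← Real.cos_nat_mul_two_pi_sub _ (n+1)]; congr 1; push_cast; ring
  rw [c1, c2, Real.cos_sub, Real.cos_add, smul_eq_mul]
  unfold cc
  have h2 : Real.sqrt 2 * Real.sqrt 2 = 2 := Real.mul_self_sqrt (by norm_num)
  field_simp
  rw [show (√2)^2 = 2 by rw [sq, h2]]
  ring

theorem inner_int (N : ℕ) (s t : ℝ) (hs : s ∈ Set.Icc (0:ℝ) 1) (ht : t ∈ Set.Icc (0:ℝ) 1) :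
    ∫ x in (0:ℝ)..1, (∑ n ∈ Finset.range (N + 1), cc n * u n s * u n t * u n x
      - trinion.indicator 1 (s, t, x)) ^ 2
    = (1 - |1 - s - t| - |s - t|)
      - ∑ n ∈ Finset.range (N + 1), cc n ^ 2 * (u n s * u n s) * (u n t * u n t) := by
  obtain ⟨hs0, hs1⟩ := hs
  obtain ⟨ht0, ht1⟩ := ht
  set A : ℝ → ℝ := fun x => ∑ n ∈ Finset.range (N + 1), cc n * u n s * u n t * u n x with hA
  have hu := u_cont
  have cA : Continuous A := by fun_prop
  have e : ∀ x ∈ Set.uIcc (0:ℝ) 1, (A x - trinion.indicator 1 (s, t, x)) ^ 2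
      = A x * A x + (Set.Icc |s - t| (1 - |1 - s - t|)).indicator (fun x => 1 - 2 * A x) x := by
    intro x hx
    rw [Set.uIcc_of_le (by norm_num)] at hx
    have hiff : (s, t, x) ∈ trinion ↔ x ∈ Set.Icc |s - t| (1 - |1 - s - t|) := by
      simp only [trinion, Set.mem_ofPred_eq, Set.mem_Icc, abs_le, le_sub_comm (a := x)]
      obtain ⟨hx0, hx1⟩ := hx
      constructor
      · rintro ⟨-, -, -, h1, ⟨h2, h3⟩, h4⟩
        refine ⟨⟨?_, ?_⟩, ?_, ?_⟩ <;> linarith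
      · rintro ⟨⟨h1, h2⟩, h3, h4⟩
        refine ⟨⟨?_, ?_⟩, ⟨?_, ?_⟩, ⟨?_, ?_⟩, ?_, ⟨?_, ?_⟩, ?_⟩ <;> linarith
    by_cases h : (s, t, x) ∈ trinion
    · rw [Set.indicator_of_mem h, Set.indicator_of_mem (hiff.1 h)]; simp; ring
    · rw [Set.indicator_of_notMem h, Set.indicator_of_notMem (fun k => h (hiff.2 k))]; ring
  have hle : |s - t| ≤ 1 - |1 - s - t| := by
    rcases abs_cases (1 - s - t) with ⟨h, _⟩ | ⟨h, _⟩ <;>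
    rcases abs_cases (s - t) with ⟨h', _⟩ | ⟨h', _⟩ <;> rw [h, h'] <;> linarith
  rw [intervalIntegral.integral_congr e, intervalIntegral.integral_add, int_ind _ _ (abs_nonneg _) hle
    (by linarith [abs_nonneg (1 - s - t)]), intervalIntegral.integral_sub,
    intervalIntegral.integral_const_mul]
  · have i1 : ∫ x in |s - t|..(1 - |1 - s - t|), A x
        = ∑ n ∈ Finset.range (N + 1), cc n ^ 2 * (u n s * u n s) * (u n t * u n t) := by
      rw [hA, intervalIntegral.integral_finsetSum]
      · refine Finset.sum_congr rfl fun n _ => ?_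
        rw [intervalIntegral.integral_const_mul, int_u]; ring
      · intro n _; exact Continuous.intervalIntegrable (by fun_prop) _ _
    have i2 : ∫ x in (0:ℝ)..1, A x * A x
        = ∑ n ∈ Finset.range (N + 1), cc n ^ 2 * (u n s * u n s) * (u n t * u n t) := by
      simp only [hA, Finset.sum_mul_sum]
      rw [intervalIntegral.integral_finsetSum]
      · refine Finset.sum_congr rfl fun n hn => ?_
        rw [intervalIntegral.integral_finsetSum]
        · have : ∀ m, ∫ x in (0:ℝ)..1, cc n * u n s * u n t * u n x * (cc m * u m s * u m t * u m x)
              = (cc n * u n s * u n t) * (cc m * u m s * u m t) * if n = m then 1 else 0 := by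
            intro m
            rw [← u_orth, ← intervalIntegral.integral_const_mul]
            congr 1; ext x; ring
          simp only [this, mul_ite, mul_one, mul_zero, Finset.sum_ite_eq, hn, if_true]
          ring
        · intro m _; exact Continuous.intervalIntegrable (by fun_prop) _ _
      · intro n _; exact Continuous.intervalIntegrable (by fun_prop) _ _
    rw [i1, i2, intervalIntegral.integral_const, smul_eq_mul]; ring
  · exact Continuous.intervalIntegrable (by fun_prop) _ _
  · exact Continuous.intervalIntegrable (by fun_prop) _ _
  · exact Continuous.intervalIntegrable (by fun_prop) _ _
  · rw [intervalIntegrable_iff]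
    refine IntegrableOn.indicator ?_ measurableSet_Icc
    rw [← intervalIntegrable_iff]
    exact Continuous.intervalIntegrable (by fun_prop) _ _

theorem int_abs (a : ℝ) (ha : a ∈ Set.Icc (0:ℝ) 1) :
    ∫ t in (0:ℝ)..1, |a - t| = (a ^ 2 + (1 - a) ^ 2) / 2 := by
  obtain ⟨h0, h1⟩ := ha
  have hc : Continuous fun t : ℝ => |a - t| := by fun_prop
  rw [← intervalIntegral.integral_add_adjacent_intervals (hc.intervalIntegrable 0 a)
    (hc.intervalIntegrable a 1)]
  have e1 : ∫ t in (0:ℝ)..a, |a - t| = ∫ t in (0:ℝ)..a, (a - t) := by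
    refine intervalIntegral.integral_congr fun t ht => ?_
    rw [Set.uIcc_of_le h0] at ht
    exact abs_of_nonneg (by linarith [ht.2])
  have e2 : ∫ t in a..(1:ℝ), |a - t| = ∫ t in a..(1:ℝ), (t - a) := by
    refine intervalIntegral.integral_congr fun t ht => ?_
    rw [Set.uIcc_of_le h1] at ht
    rw [abs_of_nonpos (by linarith [ht.1])]; ring
  rw [e1, e2, intervalIntegral.integral_sub (by simp) (by simp),
    intervalIntegral.integral_sub (by simp) (by simp)]
  simp only [integral_id, intervalIntegral.integral_const, smul_eq_mul]
  ring

theorem mid_int (N : ℕ) (s : ℝ) (hs : s ∈ Set.Icc (0:ℝ) 1) :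
    ∫ t in (0:ℝ)..1, ((1 - |1 - s - t| - |s - t|)
      - ∑ n ∈ Finset.range (N + 1), cc n ^ 2 * (u n s * u n s) * (u n t * u n t))
    = (2 * s - 2 * s ^ 2) - ∑ n ∈ Finset.range (N + 1), cc n ^ 2 * (u n s * u n s) := by
  have hu := u_cont
  rw [intervalIntegral.integral_sub (Continuous.intervalIntegrable (by fun_prop) _ _)
      (Continuous.intervalIntegrable (by fun_prop) _ _),
    intervalIntegral.integral_sub (Continuous.intervalIntegrable (by fun_prop) _ _)
      (Continuous.intervalIntegrable (by fun_prop) _ _),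
    intervalIntegral.integral_sub (Continuous.intervalIntegrable (by fun_prop) _ _)
      (Continuous.intervalIntegrable (by fun_prop) _ _),
    int_abs _ hs, int_abs (1 - s) ⟨by linarith [hs.2], by linarith [hs.1]⟩,
    intervalIntegral.integral_finsetSum
      (fun n _ => Continuous.intervalIntegrable (by fun_prop) _ _)]
  simp only [intervalIntegral.integral_const_mul, u_orth, if_true, mul_one,
    intervalIntegral.integral_const, smul_eq_mul]
  ring

theorem out_int (N : ℕ) :
    ∫ s in (0:ℝ)..1, ((2 * s - 2 * s ^ 2)
      - ∑ n ∈ Finset.range (N + 1), cc n ^ 2 * (u n s * u n s))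
    = 1 / 3 - ∑ n ∈ Finset.range (N + 1), cc n ^ 2 := by
  have hu := u_cont
  rw [intervalIntegral.integral_sub (Continuous.intervalIntegrable (by fun_prop) _ _)
      (Continuous.intervalIntegrable (by fun_prop) _ _),
    intervalIntegral.integral_sub (Continuous.intervalIntegrable (by fun_prop) _ _)
      (Continuous.intervalIntegrable (by fun_prop) _ _),
    intervalIntegral.integral_finsetSum
      (fun n _ => Continuous.intervalIntegrable (by fun_prop) _ _)]
  simp only [intervalIntegral.integral_const_mul, u_orth, if_true, mul_one,
    integral_pow]
  rw [intervalIntegral.integral_const_mul (2:ℝ) (fun x : ℝ => x), integral_id]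
  norm_num

theorem sum_cc : Tendsto (fun N : ℕ => ∑ n ∈ Finset.range (N + 1), cc n ^ 2) atTop
    (nhds (1 / 3)) := by
  have h := (hasSum_nat_add_iff' 1).2 hasSum_zeta_two
  have h2 := h.mul_left (2 / π ^ 2)
  have h3 : HasSum (fun n => cc n ^ 2) (1 / 3) := by
    have e1 : (fun n => cc n ^ 2) = fun i : ℕ => 2 / π ^ 2 * (1 / ((i + 1 : ℕ) : ℝ) ^ 2) := by
      ext n
      unfold cc
      rw [div_pow, Real.sq_sqrt (by norm_num)]
      push_cast
      field_simp
    have e2 : (1 / 3 : ℝ) = 2 / π ^ 2 * (π ^ 2 / 6 - ∑ i ∈ Finset.range 1, 1 / (i : ℝ) ^ 2) := by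
      simp; field_simp; norm_num
    rw [e1, e2]; exact h2
  exact (tendsto_add_atTop_iff_nat 1).2 h3.tendsto_sum_nat

/-- The series `Σₙ (√2/((n+1)π)) uₙ(t₁)uₙ(t₂)uₙ(t₃)` converges in `L²([0,1]³)` to the
indicator function of the trinion polytope. -/
theorem trinion_indicator_L2_expansion :
    Tendsto (fun N : ℕ =>
        ∫ t₁ in (0:ℝ)..1, ∫ t₂ in (0:ℝ)..1, ∫ t₃ in (0:ℝ)..1,
          (∑ n ∈ Finset.range (N + 1),
              (Real.sqrt 2 / (((n : ℝ) + 1) * π)) * u n t₁ * u n t₂ * u n t₃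
            - trinion.indicator 1 (t₁, t₂, t₃)) ^ 2)
      atTop (nhds 0) := by
  have key : ∀ N : ℕ, (∫ t₁ in (0:ℝ)..1, ∫ t₂ in (0:ℝ)..1, ∫ t₃ in (0:ℝ)..1,
          (∑ n ∈ Finset.range (N + 1),
              (Real.sqrt 2 / (((n : ℝ) + 1) * π)) * u n t₁ * u n t₂ * u n t₃
            - trinion.indicator 1 (t₁, t₂, t₃)) ^ 2)
      = 1 / 3 - ∑ n ∈ Finset.range (N + 1), cc n ^ 2 := by
    intro N
    rw [← out_int N]
    refine intervalIntegral.integral_congr fun s hs => ?_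
    rw [Set.uIcc_of_le (by norm_num)] at hs
    refine Eq.trans ?_ (mid_int N s hs)
    refine intervalIntegral.integral_congr fun t ht => ?_
    rw [Set.uIcc_of_le (by norm_num)] at ht
    exact inner_int N s t hs ht
  simp_rw [key]
  simpa using sum_cc.const_sub (1 / 3 : ℝ)
end

section
/- For every s ∈ [0,1], the two-dimensional Lebesgue measure of the slice 𝒫_s equals 2·s·(1−s). -/
open MeasureTheory

theorem area_Pslice (s : ℝ) (hs : s ∈ Set.Icc (0:ℝ) 1) :
    volume (Pslice s) = ENNReal.ofReal (2 * s * (1 - s)) := by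
  obtain ⟨h0, h1⟩ := hs
  let f : (ℝ × ℝ) →ₗ[ℝ] (ℝ × ℝ) :=
    Matrix.toLin (Module.Basis.finTwoProd ℝ) (Module.Basis.finTwoProd ℝ) !![1, 1; 1, -1]
  have hdet : LinearMap.det f = -2 := by
    rw [LinearMap.det_toLin, Matrix.det_fin_two_of]
    norm_num
  have hf : ∀ p : ℝ × ℝ, f p = (p.1 + p.2, p.1 - p.2) := by
    intro p
    simp only [f, Matrix.toLin_finTwoProd_apply]
    ext <;> simp <;> ring
  have hset : Pslice s = f ⁻¹' (Set.Icc s (2 - s) ×ˢ Set.Icc (-s) s) := by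
    ext p
    simp only [Pslice, Set.mem_ofPred_eq, Set.mem_preimage, hf, Set.mem_prod, Set.mem_Icc, abs_le]
    constructor
    · rintro ⟨_, _, a, b, c⟩
      exact ⟨⟨a, b⟩, c⟩
    · rintro ⟨⟨a, b⟩, c, d⟩
      refine ⟨⟨?_, ?_⟩, ⟨?_, ?_⟩, a, b, c, d⟩ <;> linarith
  rw [hset, Measure.addHaar_preimage_linearMap volume (by rw [hdet]; norm_num), hdet,
    Measure.volume_eq_prod, Measure.prod_prod, Real.volume_Icc, Real.volume_Icc,
    ← ENNReal.ofReal_mul (by linarith), ← ENNReal.ofReal_mul (abs_nonneg _)]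
  congr 1
  rw [show |((-2:ℝ))⁻¹| = 1 / 2 by rw [abs_inv, abs_neg]; norm_num]
  ring
end

section
/- The three-dimensional Lebesgue measure (volume) of the trinion polytope 𝒫 equals 1/3. -/
open MeasureTheory

theorem trinion_slice (x : ℝ) (h0 : 0 ≤ x) (h1 : x ≤ 1) :
    volume (Prod.mk x ⁻¹' trinion) = ENNReal.ofReal (2 * x * (1 - x)) := by
  let L : ℝ × ℝ →ₗ[ℝ] ℝ × ℝ :=
    Matrix.toLin (Module.Basis.finTwoProd ℝ) (Module.Basis.finTwoProd ℝ) !![1, 1; 1, -1]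
  have hL : ∀ p : ℝ × ℝ, L p = (p.1 + p.2, p.1 - p.2) := by
    intro p
    simp only [L, Matrix.toLin_finTwoProd_apply]
    ext <;> simp <;> ring
  have hd : LinearMap.det L = -2 := by
    simp only [L, LinearMap.det_toLin, Matrix.det_fin_two_of]
    norm_num
  have hs : Prod.mk x ⁻¹' trinion = L ⁻¹' (Set.Icc x (2 - x) ×ˢ Set.Icc (-x) x) := by
    ext p
    simp only [trinion, Set.mem_preimage, Set.mem_setOf_eq, hL, Set.mem_prod, Set.mem_Icc, abs_le]
    constructor
    · rintro ⟨_, _, _, _, ⟨_, _⟩, _⟩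
      refine ⟨⟨?_, ?_⟩, ?_, ?_⟩ <;> linarith
    · rintro ⟨⟨_, _⟩, _, _⟩
      refine ⟨⟨?_, ?_⟩, ⟨?_, ?_⟩, ⟨?_, ?_⟩, ?_, ⟨?_, ?_⟩, ?_⟩ <;> linarith
  rw [hs, Measure.addHaar_preimage_linearMap _ (by rw [hd]; norm_num), hd,
    Measure.volume_eq_prod, Measure.prod_prod, Real.volume_Icc, Real.volume_Icc,
    ← ENNReal.ofReal_mul (by linarith), ← ENNReal.ofReal_mul (by positivity)]
  congr 1
  rw [abs_of_neg (by norm_num)]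
  ring

theorem trinion_measurable : MeasurableSet trinion := by
  apply IsClosed.measurableSet
  simp only [trinion, Set.mem_Icc]
  repeat' apply IsClosed.and
  all_goals exact isClosed_le (by fun_prop) (by fun_prop)

theorem volume_trinion : volume trinion = ENNReal.ofReal (1 / 3) := by
  rw [Measure.volume_eq_prod, Measure.prod_apply trinion_measurable]
  have h : ∀ x : ℝ, volume (Prod.mk x ⁻¹' trinion) =
      (Set.Icc (0:ℝ) 1).indicator (fun x => ENNReal.ofReal (2 * x * (1 - x))) x := by
    intro x
    by_cases hx : x ∈ Set.Icc (0:ℝ) 1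
    · rw [Set.indicator_of_mem hx, trinion_slice x hx.1 hx.2]
    · rw [Set.indicator_of_notMem hx]
      have : Prod.mk x ⁻¹' trinion = ∅ := by
        ext p
        simp only [Set.mem_preimage, Set.mem_empty_iff_false, iff_false]
        exact fun hp => hx hp.1
      rw [this, measure_empty]
  simp_rw [h]
  rw [lintegral_indicator measurableSet_Icc, ← ofReal_integral_eq_lintegral_ofReal]
  · rw [integral_Icc_eq_integral_Ioc, ← intervalIntegral.integral_of_le zero_le_one]
    congr 1
    have : ∀ x : ℝ, 2 * x * (1 - x) = 2 * x - 2 * x ^ 2 := fun x => by ring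
    simp_rw [this]
    rw [intervalIntegral.integral_sub
      (Continuous.intervalIntegrable (by fun_prop) _ _)
      (Continuous.intervalIntegrable (by fun_prop) _ _),
      intervalIntegral.integral_const_mul, intervalIntegral.integral_const_mul,
      integral_id, integral_pow]
    norm_num
  · exact Continuous.integrableOn_Icc (by fun_prop)
  · filter_upwards [ae_restrict_mem measurableSet_Icc] with x hx
    have := hx.1
    have := sub_nonneg.2 hx.2
    simp only [Pi.zero_apply]
    positivity
end

section
/- For all s, t ∈ [0,1], the two-dimensional Lebesgue measure of the intersection 𝒫_s ∩ 𝒫_t equals 2·min(s,t)·(1−max(s,t)). Equivalently, the trace of the composition N_s∘N_t of the integral operators with kernels 𝟙_{𝒫_s} and 𝟙_{𝒫_t}, i.e. ∫₀¹∫₀¹ 𝟙_{𝒫_s}(u,v)·𝟙_{𝒫_t}(v,u) du dv, equals 2·min(s,t)·(1−max(s,t)). -/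
open MeasureTheory

lemma Pslice_aux (s t : ℝ) (hs : 0 ≤ s) (hst : s ≤ t) (ht : t ≤ 1) :
    volume (Pslice s ∩ Pslice t) = ENNReal.ofReal (2 * s * (1 - t)) := by
  let f : ℝ × ℝ →ₗ[ℝ] ℝ × ℝ :=
    Matrix.toLin (Module.Basis.finTwoProd ℝ) (Module.Basis.finTwoProd ℝ) !![1, -1; 1, 1]
  have hdet : LinearMap.det f = 2 := by
    simp only [f, LinearMap.det_toLin, Matrix.det_fin_two_of]; norm_num
  have hset : Pslice s ∩ Pslice t = f ⁻¹' (Set.Icc (-s) s ×ˢ Set.Icc t (2 - t)) := by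
    ext ⟨x, y⟩
    simp only [f, Matrix.toLin_finTwoProd_apply, Pslice, Set.mem_inter_iff, Set.mem_ofPred_eq,
      Set.mem_preimage, Set.mem_prod, Set.mem_Icc, abs_le]
    constructor
    · rintro ⟨⟨_, _, _, _, _, _⟩, _, _, _, _, _, _⟩
      refine ⟨⟨?_, ?_⟩, ?_, ?_⟩ <;> linarith
    · rintro ⟨⟨_, _⟩, _, _⟩
      refine ⟨⟨⟨?_, ?_⟩, ⟨?_, ?_⟩, ?_, ?_, ?_, ?_⟩, ⟨?_, ?_⟩, ⟨?_, ?_⟩, ?_, ?_, ?_, ?_⟩ <;> linarith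
  rw [hset, Measure.addHaar_preimage_linearMap _ (by rw [hdet]; norm_num), hdet,
    Measure.volume_eq_prod, Measure.prod_prod, Real.volume_Icc, Real.volume_Icc,
    ← ENNReal.ofReal_mul (by linarith), ← ENNReal.ofReal_mul (by positivity)]
  congr 1
  rw [abs_of_pos (by norm_num)]
  ring

lemma Pslice_swap (s x y : ℝ) : (x, y) ∈ Pslice s ↔ (y, x) ∈ Pslice s := by
  simp only [Pslice, Set.mem_ofPred_eq, abs_sub_comm x y, add_comm x y]
  tauto

lemma Pslice_meas (s : ℝ) : MeasurableSet (Pslice s) := by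
  apply IsClosed.measurableSet
  simp only [Pslice, Set.mem_Icc, Set.setOf_and]
  refine IsClosed.inter (IsClosed.inter ?_ ?_) (IsClosed.inter (IsClosed.inter ?_ ?_)
    (IsClosed.inter ?_ (IsClosed.inter ?_ ?_))) <;>
    exact isClosed_le (by fun_prop) (by fun_prop)

/-- The area of `𝒫_s ∩ 𝒫_t` is `2·min(s,t)·(1−max(s,t))`; equivalently the trace of `N_s ∘ N_t`,
`∫₀¹∫₀¹ 𝟙_{𝒫_s}(x,y)·𝟙_{𝒫_t}(y,x) dx dy`, equals `2·min(s,t)·(1−max(s,t))`. -/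
theorem area_inter_Pslice (s t : ℝ) (hs : s ∈ Set.Icc (0:ℝ) 1) (ht : t ∈ Set.Icc (0:ℝ) 1) :
    volume (Pslice s ∩ Pslice t) = ENNReal.ofReal (2 * min s t * (1 - max s t)) ∧
    ∫ y in (0:ℝ)..1, ∫ x in (0:ℝ)..1,
        (Pslice s).indicator 1 (x, y) * (Pslice t).indicator 1 (y, x)
      = 2 * min s t * (1 - max s t) := by
  have hvol : volume (Pslice s ∩ Pslice t) =
      ENNReal.ofReal (2 * min s t * (1 - max s t)) := by
    rcases le_total s t with h | h
    · rw [min_eq_left h, max_eq_right h]; exact Pslice_aux s t hs.1 h ht.2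
    · rw [min_eq_right h, max_eq_left h, Set.inter_comm]; exact Pslice_aux t s ht.1 h hs.2
  refine ⟨hvol, ?_⟩
  have hm : MeasurableSet (Pslice s ∩ Pslice t) := (Pslice_meas s).inter (Pslice_meas t)
  have hfun : ∀ x y : ℝ, (Pslice s).indicator (1 : ℝ × ℝ → ℝ) (x, y) *
      (Pslice t).indicator (1 : ℝ × ℝ → ℝ) (y, x) =
      (Pslice s ∩ Pslice t).indicator (1 : ℝ × ℝ → ℝ) (y, x) := by
    intro x y
    have h := Pslice_swap s x y
    by_cases h1 : (y, x) ∈ Pslice s <;> by_cases h2 : (y, x) ∈ Pslice t <;>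
      simp [Set.indicator, h, h1, h2]
  have hfin : volume (Pslice s ∩ Pslice t) ≠ ⊤ := by rw [hvol]; exact ENNReal.ofReal_ne_top
  have hint : Integrable ((Pslice s ∩ Pslice t).indicator (1 : ℝ × ℝ → ℝ)) :=
    (integrable_indicator_iff hm).2 (integrableOn_const hfin)
  have hsub : Pslice s ∩ Pslice t ⊆ Set.Icc (0:ℝ) 1 ×ˢ Set.Icc (0:ℝ) 1 :=
    fun p hp => ⟨hp.1.1, hp.1.2.1⟩
  simp only [hfun, intervalIntegral.integral_of_le zero_le_one, ← integral_Icc_eq_integral_Ioc]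
  rw [← setIntegral_prod (μ := volume) (ν := volume)
    ((Pslice s ∩ Pslice t).indicator (1 : ℝ × ℝ → ℝ)) hint.integrableOn,
    ← Measure.volume_eq_prod, integral_indicator_one hm, measureReal_restrict_apply hm,
    Set.inter_eq_left.2 hsub, Measure.real, hvol, ENNReal.toReal_ofReal]
  have := le_min hs.1 ht.1
  have := max_le hs.2 ht.2
  exact mul_nonneg (by linarith) (by linarith)
end

section
/- For all s, t ∈ [0,1], the series Σ_{n=0}^∞ (4/((n+1)²·π²)) · sin((n+1)·π·s) · sin((n+1)·π·t) converges and its sum equals 2·min(s,t)·(1−max(s,t)). -/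
open Real

lemma aux_cos (x : ℝ) (hx : x ∈ Set.Icc (0:ℝ) 1) :
    HasSum (fun n : ℕ => 1 / (n : ℝ) ^ 2 * Real.cos (2 * π * n * x))
      (π ^ 2 * (x ^ 2 - x + 1 / 6)) := by
  have h := hasSum_one_div_nat_pow_mul_cos (k := 1) one_ne_zero hx
  convert! h using 1
  have hb : (Polynomial.map (algebraMap ℚ ℝ) (Polynomial.bernoulli (2 * 1))).eval x
      = x ^ 2 - x + 1 / 6 := by
    have h2 : bernoulli 2 = 1 / 6 := by
      rw [bernoulli_eq_bernoulli'_of_ne_one (by decide), bernoulli'_two]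
    simp [Polynomial.bernoulli, Finset.sum_range_succ, h2, bernoulli_one]
    ring
  rw [hb]
  simp only [mul_one, Nat.factorial_two, Nat.cast_ofNat]
  ring

lemma aux_le (s t : ℝ) (hs : s ∈ Set.Icc (0:ℝ) 1)
    (ht : t ∈ Set.Icc (0:ℝ) 1) (hst : s ≤ t) :
    HasSum (fun n : ℕ =>
        (4 / (((n : ℝ) + 1) ^ 2 * π ^ 2)) * Real.sin (((n : ℝ) + 1) * π * s) *
          Real.sin (((n : ℝ) + 1) * π * t))
      (2 * s * (1 - t)) := by
  obtain ⟨hs0, hs1⟩ := hs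
  obtain ⟨ht0, ht1⟩ := ht
  have ha := aux_cos ((t - s) / 2) ⟨by linarith, by linarith⟩
  have hb := aux_cos ((t + s) / 2) ⟨by linarith, by linarith⟩
  have h := (ha.sub hb).mul_left (2 / π ^ 2)
  rw [← hasSum_nat_add_iff' 1] at h
  have hpi : π ≠ 0 := Real.pi_ne_zero
  convert! h using 1
  · funext n
    have hn : (n : ℝ) + 1 ≠ 0 := by positivity
    have e1 : 2 * π * ((n + 1 : ℕ) : ℝ) * ((t - s) / 2)
        = ((n : ℝ) + 1) * π * t - ((n : ℝ) + 1) * π * s := by push_cast; ring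
    have e2 : 2 * π * ((n + 1 : ℕ) : ℝ) * ((t + s) / 2)
        = ((n : ℝ) + 1) * π * t + ((n : ℝ) + 1) * π * s := by push_cast; ring
    rw [e1, e2, Real.cos_sub, Real.cos_add]
    push_cast
    field_simp
    ring
  · simp
    field_simp
    ring

/-- Spectral expansion of the kernel `M(s,t) = 2·min(s,t)·(1−max(s,t))`:
`Σₙ (4/((n+1)²π²))·sin((n+1)πs)·sin((n+1)πt) = 2·min(s,t)·(1−max(s,t))`. -/
theorem kernelM_spectral_expansion (s t : ℝ) (hs : s ∈ Set.Icc (0:ℝ) 1)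
    (ht : t ∈ Set.Icc (0:ℝ) 1) :
    HasSum (fun n : ℕ =>
        (4 / (((n : ℝ) + 1) ^ 2 * π ^ 2)) * Real.sin (((n : ℝ) + 1) * π * s) *
          Real.sin (((n : ℝ) + 1) * π * t))
      (2 * min s t * (1 - max s t)) := by
  rcases le_total s t with h | h
  · rw [min_eq_left h, max_eq_right h]
    exact aux_le s t hs ht h
  · rw [min_eq_right h, max_eq_left h]
    convert! aux_le t s ht hs h using 2
    ring
end

section
/- Let μ be the Haar probability measure on the compact group SU(2) (the special unitary group of 2×2 complex matrices). For every continuous function f : ℝ → ℝ, ∫_{SU(2)} f(Re(trace g)) dμ(g) = ∫₀¹ f(2·cos(π·t)) · 2·sin²(π·t) dt. (The trace of an element of SU(2) is real, and equals 2·cos(π·t) for a unique t ∈ [0,1].) -/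
open MeasureTheory Real

/-- `SU(2)`: the subgroup of the unitary group of `2×2` complex matrices consisting of the
matrices of determinant `1`. -/
def SU2 : Subgroup (Matrix.unitaryGroup (Fin 2) ℂ) where
  carrier := {g | (g : Matrix (Fin 2) (Fin 2) ℂ).det = 1}
  mul_mem' := by
    intro a b ha hb
    simp only [Set.mem_setOf_eq, Matrix.UnitaryGroup.mul_val, Matrix.det_mul] at *
    rw [ha, hb, one_mul]
  one_mem' := by
    simp only [Set.mem_setOf_eq, Matrix.UnitaryGroup.one_val, Matrix.det_one]
  inv_mem' := by
    intro a ha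
    simp only [Set.mem_setOf_eq, Matrix.UnitaryGroup.inv_val] at *
    rw [Matrix.star_eq_conjTranspose, Matrix.det_conjTranspose, ha, star_one]

namespace SU2aux

abbrev M (g : SU2) : Matrix (Fin 2) (Fin 2) ℂ := ((g : Matrix.unitaryGroup (Fin 2) ℂ) : Matrix (Fin 2) (Fin 2) ℂ)

lemma col_norm (g : SU2) :
    (M g 0 0).re ^ 2 + (M g 0 0).im ^ 2 + (M g 1 0).re ^ 2 + (M g 1 0).im ^ 2 = 1 := by
  have h : star (M g) * M g = 1 := Matrix.UnitaryGroup.star_mul_self _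
  have h0 := congrArg (fun A : Matrix (Fin 2) (Fin 2) ℂ => (A 0 0).re) h
  simp [Matrix.mul_apply, Fin.sum_univ_two, Matrix.star_apply] at h0
  nlinarith [h0]

lemma trace_re (g : SU2) : (M g).trace.re = 2 * (M g 0 0).re := by
  have h : star (M g) * M g = 1 := Matrix.UnitaryGroup.star_mul_self _
  have h' : M g * star (M g) = 1 := mul_eq_one_comm.mp h
  have hd : (M g).det = 1 := g.2
  have ha : (M g).adjugate = star (M g) := by
    have : (M g).adjugate * M g = 1 := by rw [Matrix.adjugate_mul, hd, one_smul]
    calc (M g).adjugate = (M g).adjugate * (M g * star (M g)) := by rw [h', mul_one]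
      _ = star (M g) := by rw [← mul_assoc, this, one_mul]
  have h0 := congrArg (fun A : Matrix (Fin 2) (Fin 2) ℂ => (A 0 0).re) ha
  simp [Matrix.adjugate_fin_two, Matrix.star_apply] at h0
  rw [Matrix.trace_fin_two, Complex.add_re, h0]; ring

noncomputable def mk (a b : ℂ) (h : a.re ^ 2 + a.im ^ 2 + b.re ^ 2 + b.im ^ 2 = 1) : SU2 :=
  ⟨⟨!![a, -star b; b, star a], by
    rw [Matrix.mem_unitaryGroup_iff]
    ext i j
    fin_cases i <;> fin_cases j <;>
      simp [Matrix.mul_apply, Fin.sum_univ_two, Matrix.star_apply, Complex.ext_iff] <;>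
      constructor <;> nlinarith [h]⟩, by
    change Matrix.det !![a, -star b; b, star a] = 1
    simp [Matrix.det_fin_two, Complex.ext_iff]
    constructor <;> nlinarith [h]⟩

lemma mk_mul_00 (a b : ℂ) (h) (g : SU2) : M (mk a b h * g) 0 0 = a * M g 0 0 - star b * M g 1 0 := by
  change (!![a, -star b; b, star a] * M g) 0 0 = _
  simp [Matrix.mul_apply, Fin.sum_univ_two]; ring

lemma mk_mul_10 (a b : ℂ) (h) (g : SU2) : M (mk a b h * g) 1 0 = b * M g 0 0 + star a * M g 1 0 := by
  change (!![a, -star b; b, star a] * M g) 1 0 = _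
  simp [Matrix.mul_apply, Fin.sum_univ_two]

lemma cont_M (i j : Fin 2) : Continuous (fun g : SU2 => M g i j) :=
  (continuous_subtype_val.comp continuous_subtype_val).matrix_elem i j

lemma stein [MeasurableSpace SU2] [BorelSpace SU2]
    (μ : Measure SU2) [μ.IsHaarMeasure] [IsProbabilityMeasure μ]
    (h : ℝ → SU2) (X Y : SU2 → ℝ) (hX : Continuous X) (hY : Continuous Y)
    (bX : ∀ g, |X g| ≤ 1) (bY : ∀ g, |Y g| ≤ 1)
    (eX : ∀ s g, X (h s * g) = cos s * X g - sin s * Y g)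
    (eY : ∀ s g, Y (h s * g) = sin s * X g + cos s * Y g) (n : ℕ) :
    ∫ g, (n * X g ^ (n-1) * Y g ^ 2 - X g ^ (n+1)) ∂μ = 0 := by
  have inv : ∀ s, ∫ g, (cos s * X g - sin s * Y g)^n * (sin s * X g + cos s * Y g) ∂μ
      = ∫ g, X g ^ n * Y g ∂μ := by
    intro s
    rw [← integral_mul_left_eq_self (fun g => X g ^ n * Y g) (h s)]
    simp only [eX, eY]
  have b1 : ∀ s g, |cos s * X g - sin s * Y g| ≤ 2 := by
    intro s g
    have h1 : |cos s * X g| ≤ 1 := by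
      rw [abs_mul]; exact mul_le_one₀ (abs_cos_le_one s) (abs_nonneg _) (bX g)
    have h2 : |sin s * Y g| ≤ 1 := by
      rw [abs_mul]; exact mul_le_one₀ (abs_sin_le_one s) (abs_nonneg _) (bY g)
    linarith [abs_sub (cos s * X g) (sin s * Y g)]
  have b2 : ∀ s g, |sin s * X g + cos s * Y g| ≤ 2 := by
    intro s g
    have h1 : |sin s * X g| ≤ 1 := by
      rw [abs_mul]; exact mul_le_one₀ (abs_sin_le_one s) (abs_nonneg _) (bX g)
    have h2 : |cos s * Y g| ≤ 1 := by
      rw [abs_mul]; exact mul_le_one₀ (abs_cos_le_one s) (abs_nonneg _) (bY g)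
    linarith [abs_add_le (sin s * X g) (cos s * Y g)]
  have key := (hasDerivAt_integral_of_dominated_loc_of_deriv_le (μ := μ) (𝕜 := ℝ)
    (F := fun s g => (cos s * X g - sin s * Y g)^n * (sin s * X g + cos s * Y g))
    (F' := fun s g => - (n * (cos s * X g - sin s * Y g)^(n-1) * (sin s * X g + cos s * Y g)^2)
      + (cos s * X g - sin s * Y g)^n * (cos s * X g - sin s * Y g))
    (x₀ := 0) (s := Set.univ) (bound := fun _ => n * 2^(n-1) * 2^2 + 2^n*2)
    Filter.univ_mem ?_ ?_ ?_ ?_ ?_ ?_).2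
  · simp only [inv] at key
    have := key.unique (hasDerivAt_const _ _)
    simp only [cos_zero, sin_zero, one_mul, zero_mul, sub_zero, zero_add] at this
    rw [← neg_eq_zero, ← integral_neg, ← this]
    congr 1; ext g; ring
  · exact Filter.Eventually.of_forall fun s => by
      apply Continuous.aestronglyMeasurable; fun_prop
  · apply Integrable.of_bound (C := 2^n*2)
    · apply Continuous.aestronglyMeasurable; fun_prop
    · refine Filter.Eventually.of_forall fun g => ?_
      rw [Real.norm_eq_abs, abs_mul, abs_pow]
      gcongr
      · exact b1 0 g
      · exact b2 0 g
  · apply Continuous.aestronglyMeasurable; fun_prop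
  · refine Filter.Eventually.of_forall fun g s _ => ?_
    rw [Real.norm_eq_abs]
    refine (abs_add_le _ _).trans ?_
    rw [abs_neg, abs_mul, abs_mul, abs_mul, abs_pow, abs_pow, abs_pow, Nat.abs_cast]
    gcongr
    · exact b1 s g
    · exact b2 s g
    · exact b1 s g
    · exact b1 s g
  · exact integrable_const _
  · refine Filter.Eventually.of_forall fun g s _ => ?_
    have d1 : HasDerivAt (fun s => cos s * X g - sin s * Y g) (-sin s * X g - cos s * Y g) s :=
      ((hasDerivAt_cos s).mul_const _).sub ((hasDerivAt_sin s).mul_const _)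
    have d2 : HasDerivAt (fun s => sin s * X g + cos s * Y g) (cos s * X g + -sin s * Y g) s :=
      ((hasDerivAt_sin s).mul_const _).add ((hasDerivAt_cos s).mul_const _)
    refine HasDerivAt.congr_deriv ((d1.pow n).mul d2) ?_
    simp only [Pi.pow_apply]
    ring

lemma abs_le_of_sq {x : ℝ} (h : x ^ 2 ≤ 1) : |x| ≤ 1 := by
  rwa [← sq_le_one_iff_abs_le_one]

lemma x0_le (g : SU2) : |(M g 0 0).re| ≤ 1 := by
  have := col_norm g; apply abs_le_of_sq; nlinarith

lemma int_pow [MeasurableSpace SU2] [BorelSpace SU2]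
    (μ : Measure SU2) [IsProbabilityMeasure μ] (n : ℕ) :
    Integrable (fun g : SU2 => (M g 0 0).re ^ n) μ := by
  have c := Complex.continuous_re.comp (cont_M 0 0)
  apply Integrable.of_bound (C := 1) ((c.pow n).aestronglyMeasurable)
  refine Filter.Eventually.of_forall fun g => ?_
  rw [Real.norm_eq_abs]
  simp only [Pi.pow_apply, Function.comp]
  rw [abs_pow]
  exact pow_le_one₀ (abs_nonneg _) (x0_le g)

lemma mom [MeasurableSpace SU2] [BorelSpace SU2]
    (μ : Measure SU2) [μ.IsHaarMeasure] [IsProbabilityMeasure μ] (n : ℕ) :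
    (n:ℝ) * ∫ g, (M g 0 0).re ^ (n-1) ∂μ = ((n:ℝ) + 3) * ∫ g, (M g 0 0).re ^ (n+1) ∂μ := by
  have cr := Complex.continuous_re.comp (cont_M 0 0)
  have ci := Complex.continuous_im.comp (cont_M 0 0)
  have cr1 := Complex.continuous_re.comp (cont_M 1 0)
  have ci1 := Complex.continuous_im.comp (cont_M 1 0)
  have B1 : ∀ g : SU2, |(M g 0 0).im| ≤ 1 := fun g => by
    have := col_norm g; apply abs_le_of_sq; nlinarith
  have B2 : ∀ g : SU2, |(M g 1 0).re| ≤ 1 := fun g => by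
    have := col_norm g; apply abs_le_of_sq; nlinarith
  have B3 : ∀ g : SU2, |(M g 1 0).im| ≤ 1 := fun g => by
    have := col_norm g; apply abs_le_of_sq; nlinarith
  have s1 := stein μ (fun s => mk ⟨cos s, sin s⟩ 0 (by simp)) (fun g => (M g 0 0).re)
    (fun g => (M g 0 0).im) cr ci x0_le B1
    (fun s g => by simp only [mk_mul_00]; simp)
    (fun s g => by simp only [mk_mul_00]; simp; ring) n
  have s2 := stein μ (fun s => mk ⟨cos s, 0⟩ ⟨sin s, 0⟩ (by simp)) (fun g => (M g 0 0).re)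
    (fun g => (M g 1 0).re) cr cr1 x0_le B2
    (fun s g => by simp only [mk_mul_00]; simp)
    (fun s g => by simp only [mk_mul_10]; simp) n
  have s3 := stein μ (fun s => mk ⟨cos s, 0⟩ ⟨0, sin s⟩ (by simp)) (fun g => (M g 0 0).re)
    (fun g => (M g 1 0).im) cr ci1 x0_le B3
    (fun s g => by simp only [mk_mul_00]; simp)
    (fun s g => by simp only [mk_mul_10]; simp) n
  have I : ∀ Y : SU2 → ℝ, Continuous Y → (∀ g, |Y g| ≤ 1) →
      Integrable (fun g => n * (M g 0 0).re ^ (n-1) * Y g ^ 2 - (M g 0 0).re ^ (n+1)) μ := by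
    intro Y hY bY
    refine Integrable.sub ?_ (int_pow μ _)
    refine Integrable.mul_bdd (c := 1) ((int_pow μ _).const_mul _) (hY.pow 2).aestronglyMeasurable ?_
    refine Filter.Eventually.of_forall fun g => ?_
    simp only [Pi.pow_apply, norm_pow, Real.norm_eq_abs]
    exact pow_le_one₀ (abs_nonneg _) (bY g)
  have tot := integral_add ((I _ ci B1).add (I _ cr1 B2)) (I _ ci1 B3)
  have tot2 := integral_add (I _ ci B1) (I _ cr1 B2)
  simp only [Pi.add_apply, Function.comp] at tot tot2
  rw [tot2, s1, s2, s3] at tot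
  have e : ∀ g : SU2, n * (M g 0 0).re ^ (n-1) * (M g 0 0).im ^ 2 - (M g 0 0).re ^ (n+1) +
      (n * (M g 0 0).re ^ (n-1) * (M g 1 0).re ^ 2 - (M g 0 0).re ^ (n+1)) +
      (n * (M g 0 0).re ^ (n-1) * (M g 1 0).im ^ 2 - (M g 0 0).re ^ (n+1))
      = n * (M g 0 0).re ^ (n-1) - (n+3) * (M g 0 0).re ^ (n+1) := by
    intro g
    have h := col_norm g
    have h2 : (n:ℝ) * (M g 0 0).re ^ (n+1) = n * (M g 0 0).re ^ (n-1) * (M g 0 0).re ^ 2 := by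
      rcases n with _ | k
      · simp
      · simp only [Nat.add_sub_cancel]; ring
    linear_combination (n * (M g 0 0).re ^ (n-1)) * h + h2
  simp only [e] at tot
  rw [integral_sub ((int_pow μ _).const_mul _) ((int_pow μ _).const_mul _),
    integral_const_mul, integral_const_mul] at tot
  linarith

lemma mom' (n : ℕ) :
    (n:ℝ) * ∫ t in (0:ℝ)..1, cos (π * t) ^ (n-1) * (2 * sin (π * t) ^ 2) =
      ((n:ℝ) + 3) * ∫ t in (0:ℝ)..1, cos (π * t) ^ (n+1) * (2 * sin (π * t) ^ 2) := by
  have d : ∀ t ∈ Set.uIcc (0:ℝ) 1, HasDerivAt (fun t => cos (π * t) ^ n * sin (π * t) ^ 3)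
      (n * cos (π * t) ^ (n-1) * (-sin (π * t) * (π * 1)) * sin (π * t) ^ 3
        + cos (π * t) ^ n * ((3:ℕ) * sin (π * t) ^ 2 * (cos (π * t) * (π * 1)))) t := by
    intro t _
    have h1 : HasDerivAt (fun t => π * t) (π * 1) t := (hasDerivAt_id t).const_mul π
    exact (h1.cos.pow n).mul (h1.sin.pow 3)
  have key := intervalIntegral.integral_eq_sub_of_hasDerivAt d
    (Continuous.intervalIntegrable (by fun_prop) _ _)
  simp at key
  have e : ∀ t : ℝ, -(n * cos (π * t) ^ (n-1) * (sin (π * t) * π) * sin (π * t) ^ 3)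
        + cos (π * t) ^ n * (3 * sin (π * t) ^ 2 * (cos (π * t) * π)) =
      (π / 2) * ((n + 3) * (cos (π * t) ^ (n+1) * (2 * sin (π * t) ^ 2)) -
       n * (cos (π * t) ^ (n-1) * (2 * sin (π * t) ^ 2))) := by
    intro t
    have h := sin_sq_add_cos_sq (π * t)
    have h2 : (n:ℝ) * cos (π * t) ^ (n+1) = n * cos (π * t) ^ (n-1) * cos (π * t) ^ 2 := by
      rcases n with _ | k
      · simp
      · simp only [Nat.add_sub_cancel]; ring
    linear_combination (-(n * cos (π * t) ^ (n-1) * π * sin (π * t) ^ 2)) * h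
      - (π * sin (π * t) ^ 2) * h2
  simp only [e] at key
  rw [intervalIntegral.integral_const_mul, intervalIntegral.integral_sub
    (Continuous.intervalIntegrable (by fun_prop) _ _)
    (Continuous.intervalIntegrable (by fun_prop) _ _), intervalIntegral.integral_const_mul,
    intervalIntegral.integral_const_mul] at key
  have := (mul_eq_zero.mp key).resolve_left (by positivity)
  linarith

lemma mass : ∫ t in (0:ℝ)..1, (2 * sin (π * t) ^ 2) = 1 := by
  have := intervalIntegral.integral_comp_mul_left (a := 0) (b := 1) (fun x => 2 * sin x ^ 2) pi_ne_zero
  rw [this]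
  simp [integral_sin_sq]
  field_simp

lemma mom_eq [MeasurableSpace SU2] [BorelSpace SU2]
    (μ : Measure SU2) [μ.IsHaarMeasure] [IsProbabilityMeasure μ] (n : ℕ) :
    ∫ g, (M g 0 0).re ^ n ∂μ = ∫ t in (0:ℝ)..1, cos (π * t) ^ n * (2 * sin (π * t) ^ 2) := by
  induction n using Nat.strong_induction_on with
  | _ n ih =>
    rcases n with _ | n
    · simp only [pow_zero, one_mul, mass]; simp
    · have h1 := mom μ n
      have h2 := mom' n
      rw [ih (n-1) (by omega), h2] at h1
      exact (mul_left_cancel₀ (by positivity) h1).symm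

lemma poly_eq [MeasurableSpace SU2] [BorelSpace SU2]
    (μ : Measure SU2) [μ.IsHaarMeasure] [IsProbabilityMeasure μ] (p : Polynomial ℝ) :
    ∫ g, p.eval (M g 0 0).re ∂μ = ∫ t in (0:ℝ)..1, p.eval (cos (π * t)) * (2 * sin (π * t) ^ 2) := by
  simp only [Polynomial.eval_eq_sum_range, Finset.sum_mul, mul_assoc]
  rw [integral_finsetSum _ (fun i _ => (int_pow μ i).const_mul _),
    intervalIntegral.integral_finsetSum (fun i _ => Continuous.intervalIntegrable (by fun_prop) _ _)]
  refine Finset.sum_congr rfl fun i _ => ?_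
  rw [integral_const_mul, intervalIntegral.integral_const_mul, mom_eq]

lemma cont_eq [MeasurableSpace SU2] [BorelSpace SU2]
    (μ : Measure SU2) [μ.IsHaarMeasure] [IsProbabilityMeasure μ] (f : ℝ → ℝ) (hf : Continuous f) :
    ∫ g, f (M g 0 0).re ∂μ = ∫ t in (0:ℝ)..1, f (cos (π * t)) * (2 * sin (π * t) ^ 2) := by
  have cr : Continuous (fun g : SU2 => (M g 0 0).re) := Complex.continuous_re.comp (cont_M 0 0)
  have I : ∀ f : ℝ → ℝ, Continuous f → Integrable (fun g : SU2 => f (M g 0 0).re) μ := by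
    intro f hf
    obtain ⟨C, hC⟩ := (isCompact_Icc (a := (-1:ℝ)) (b := 1)).exists_bound_of_continuousOn hf.continuousOn
    exact Integrable.of_bound (C := C) (hf.comp cr).aestronglyMeasurable
      (Filter.Eventually.of_forall fun g => hC _ (abs_le.mp (x0_le g)))
  apply eq_of_abs_sub_le_all
  intro ε hε
  obtain ⟨p, hp⟩ := exists_polynomial_near_of_continuousOn (-1) 1 f hf.continuousOn (ε/2) (by positivity)
  have h1 : |∫ g, f (M g 0 0).re ∂μ - ∫ g, p.eval (M g 0 0).re ∂μ| ≤ ε/2 := by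
    rw [← integral_sub (I f hf) (I _ p.continuous)]
    have := norm_integral_le_of_norm_le_const (μ := μ) (C := ε/2)
      (f := fun g => f (M g 0 0).re - p.eval (M g 0 0).re)
      (Filter.Eventually.of_forall fun g => by
        rw [Real.norm_eq_abs, abs_sub_comm]; exact (hp _ (abs_le.mp (x0_le g))).le)
    simpa using this
  have h2 : |(∫ t in (0:ℝ)..1, f (cos (π * t)) * (2 * sin (π * t) ^ 2)) -
      ∫ t in (0:ℝ)..1, p.eval (cos (π * t)) * (2 * sin (π * t) ^ 2)| ≤ ε/2 := by
    have cp := p.continuous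
    rw [← intervalIntegral.integral_sub (Continuous.intervalIntegrable (by fun_prop) _ _)
      (Continuous.intervalIntegrable (by fun_prop) _ _)]
    have := intervalIntegral.norm_integral_le_of_norm_le (μ := volume) (a := (0:ℝ)) (b := 1) zero_le_one
      (f := fun t => f (cos (π * t)) * (2 * sin (π * t) ^ 2) - p.eval (cos (π * t)) * (2 * sin (π * t) ^ 2))
      (g := fun t => ε/2 * (2 * sin (π * t) ^ 2))
      (Filter.Eventually.of_forall fun t _ => by
        rw [← sub_mul, norm_mul, Real.norm_eq_abs, abs_sub_comm, Real.norm_of_nonneg (by positivity : 0 ≤ 2 * sin (π * t) ^ 2)]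
        gcongr
        exact (hp _ ⟨neg_one_le_cos _, cos_le_one _⟩).le)
      (Continuous.intervalIntegrable (by fun_prop) _ _)
    rw [intervalIntegral.integral_const_mul, mass, mul_one] at this
    exact this
  rw [poly_eq] at h1
  rw [abs_le] at *
  constructor <;> linarith [h1.1, h1.2, h2.1, h2.2]

end SU2aux

/-- Weyl integration for class functions on `SU(2)`: if `μ` is the Haar probability measure on
`SU(2)`, then for every continuous `f : ℝ → ℝ`,
`∫ f(Re tr g) dμ(g) = ∫₀¹ f(2cos(πt))·2sin²(πt) dt`. -/
theorem su2_haar_trace_distribution [MeasurableSpace SU2] [BorelSpace SU2]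
    (μ : Measure SU2) [μ.IsHaarMeasure] [IsProbabilityMeasure μ]
    (f : ℝ → ℝ) (hf : Continuous f) :
    (∫ g : SU2, f ((((g : Matrix.unitaryGroup (Fin 2) ℂ) : Matrix (Fin 2) (Fin 2) ℂ).trace).re) ∂μ)
      = ∫ t in (0:ℝ)..1, f (2 * Real.cos (π * t)) * (2 * Real.sin (π * t) ^ 2) := by
  simp only [SU2aux.trace_re]
  exact SU2aux.cont_eq μ (fun x => f (2 * x)) (by fun_prop)
end

section
/- For every integer k ≥ 1, the cyclic iterated integral ∫_{[0,1]^k} M(t₁,t₂)·M(t₂,t₃)⋯M(t_{k−1},t_k)·M(t_k,t₁) dt₁⋯dt_k equals (2/π²)^k · ζ(2k), where ζ is the Riemann zeta function. (For k = 1 this reads ∫₀¹ M(t,t) dt = (2/π²)·ζ(2) = 1/3.) -/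
open MeasureTheory Real

/-- The kernel `M(s,t) = 2·min(s,t)·(1−max(s,t))` on `[0,1]²`. -/
def Mker (s t : ℝ) : ℝ := 2 * min s t * (1 - max s t)

lemma bern2 (x : ℝ) :
    (Polynomial.map (algebraMap ℚ ℝ) (Polynomial.bernoulli 2)).eval x = x^2-x+1/6 := by
  simp [Polynomial.bernoulli, Finset.sum_range_succ]
  ring

lemma cosSum {x : ℝ} (hx : x ∈ Set.Icc (0:ℝ) 1) :
    HasSum (fun n : ℕ => 1 / (n:ℝ)^2 * cos (2 * π * n * x)) (π^2 * (x^2-x+1/6)) := by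
  have h := hasSum_one_div_nat_pow_mul_cos (k := 1) one_ne_zero hx
  rw [show 2 * 1 = 2 from rfl, bern2] at h
  convert! h using 1
  rw [Nat.factorial_two]
  push_cast
  ring

/-- eigenvalues -/
noncomputable def lam (n : ℕ) : ℝ := 2 / ((n:ℝ)^2 * π^2)

lemma lam_nonneg (n : ℕ) : 0 ≤ lam n := by unfold lam; positivity

lemma Mker_symm (s t : ℝ) : Mker s t = Mker t s := by
  simp [Mker, min_comm, max_comm]

lemma mercer_aux {s t : ℝ} (hs : s ∈ Set.Icc (0:ℝ) 1) (ht : t ∈ Set.Icc (0:ℝ) 1) (h : s ≤ t) :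
    HasSum (fun n : ℕ => lam n * (2 * sin (n * π * s) * sin (n * π * t))) (Mker s t) := by
  obtain ⟨hs0, hs1⟩ := hs
  obtain ⟨ht0, ht1⟩ := ht
  have h1 := cosSum (x := (t - s)/2) ⟨by linarith, by linarith⟩
  have h2 := cosSum (x := (t + s)/2) ⟨by linarith, by linarith⟩
  have h3 := (h1.sub h2).mul_left (2 / π^2)
  convert! h3 using 1
  · ext n
    rw [show 2 * π * n * ((t-s)/2) = n * π * t - n * π * s by ring,
      show 2 * π * n * ((t+s)/2) = n * π * t + n * π * s by ring, cos_sub, cos_add, lam]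
    by_cases hn : (n:ℝ) = 0
    · simp [hn]
    · field_simp
      ring
  · rw [Mker, min_eq_left h, max_eq_right h]
    field_simp
    ring

lemma mercer {s t : ℝ} (hs : s ∈ Set.Icc (0:ℝ) 1) (ht : t ∈ Set.Icc (0:ℝ) 1) :
    HasSum (fun n : ℕ => lam n * (2 * sin (n * π * s) * sin (n * π * t))) (Mker s t) := by
  rcases le_total s t with h | h
  · exact mercer_aux hs ht h
  · rw [Mker_symm]
    convert! mercer_aux ht hs h using 2
    ring

lemma Mker_cont : Continuous (fun p : ℝ × ℝ => Mker p.1 p.2) := by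
  unfold Mker; fun_prop

lemma Mker_bound {s t : ℝ} (hs : s ∈ Set.Icc (0:ℝ) 1) (ht : t ∈ Set.Icc (0:ℝ) 1) :
    |Mker s t| ≤ 2 := by
  obtain ⟨hs0, hs1⟩ := hs
  obtain ⟨ht0, ht1⟩ := ht
  unfold Mker
  have a1 : 0 ≤ min s t := le_min hs0 ht0
  have a2 : min s t ≤ 1 := (min_le_left _ _).trans hs1
  have a3 : 0 ≤ max s t := le_max_of_le_left hs0
  have a4 : max s t ≤ 1 := max_le hs1 ht1
  rw [abs_le]
  constructor <;> nlinarith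

lemma eigen {s : ℝ} (hs : s ∈ Set.Icc (0:ℝ) 1) {n : ℕ} (hn : n ≠ 0) :
    ∫ u in Set.Icc (0:ℝ) 1, Mker s u * sin (n * π * u) = lam n * sin (n * π * s) := by
  obtain ⟨hs0, hs1⟩ := hs
  have hn' : (n:ℝ) ≠ 0 := by exact_mod_cast hn
  obtain ⟨a, ha⟩ : ∃ a : ℝ, a = n * π := ⟨_, rfl⟩
  have ha0 : a ≠ 0 := by rw [ha]; positivity
  have hsa : sin a = 0 := by rw [ha]; exact sin_nat_mul_pi n
  have hl : lam n = 2 / a^2 := by rw [ha, lam]; ring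
  rw [hl, ← ha, integral_Icc_eq_integral_Ioc, ← intervalIntegral.integral_of_le zero_le_one]
  have hc : Continuous (fun u => Mker s u * sin (a * u)) := by
    unfold Mker; fun_prop
  rw [← intervalIntegral.integral_add_adjacent_intervals (b := s)
    (hc.intervalIntegrable _ _) (hc.intervalIntegrable _ _)]
  have e1 : ∫ u in (0:ℝ)..s, Mker s u * sin (a * u)
      = ∫ u in (0:ℝ)..s, 2 * (1 - s) * (u * sin (a * u)) := by
    apply intervalIntegral.integral_congr
    intro u hu
    rw [Set.uIcc_of_le hs0] at hu
    simp only [Mker, min_eq_right hu.2, max_eq_left hu.2]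
    ring
  have e2 : ∫ u in s..(1:ℝ), Mker s u * sin (a * u)
      = ∫ u in s..(1:ℝ), 2 * s * ((1 - u) * sin (a * u)) := by
    apply intervalIntegral.integral_congr
    intro u hu
    rw [Set.uIcc_of_le hs1] at hu
    simp only [Mker, min_eq_left hu.1, max_eq_right hu.1]
    ring
  have hlin (u : ℝ) : HasDerivAt (fun u => a * u) a u := by
    simpa using (hasDerivAt_id u).const_mul a
  have f1 : ∫ u in (0:ℝ)..s, 2 * (1 - s) * (u * sin (a * u)) =
      (2 * (1 - s) * (sin (a * s) / a^2 - s * cos (a * s) / a)) -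
      (2 * (1 - s) * (sin (a * 0) / a^2 - 0 * cos (a * 0) / a)) := by
    apply intervalIntegral.integral_eq_sub_of_hasDerivAt
      (f := fun u => 2 * (1 - s) * (sin (a * u) / a^2 - u * cos (a * u) / a))
    · intro u _
      convert! ((((hlin u).sin).div_const (a^2)).sub
        (((hasDerivAt_id u).mul ((hlin u).cos)).div_const a)).const_mul (2 * (1-s)) using 1
      try simp only [id]
      field_simp
      ring
    · apply Continuous.intervalIntegrable
      fun_prop
  have f2 : ∫ u in s..(1:ℝ), 2 * s * ((1 - u) * sin (a * u)) =
      (2 * s * (- ((1 - 1) * cos (a * 1) / a) - sin (a * 1) / a^2)) -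
      (2 * s * (- ((1 - s) * cos (a * s) / a) - sin (a * s) / a^2)) := by
    apply intervalIntegral.integral_eq_sub_of_hasDerivAt
      (f := fun u => 2 * s * (- ((1 - u) * cos (a * u) / a) - sin (a * u) / a^2))
    · intro u _
      convert! ((((((hasDerivAt_id u).const_sub 1).mul ((hlin u).cos)).div_const a).neg).sub
        (((hlin u).sin).div_const (a^2))).const_mul (2 * s) using 1
      try simp only [id]
      field_simp
      ring
    · apply Continuous.intervalIntegrable
      fun_prop
  rw [e1, e2, f1, f2]
  simp [hsa]
  field_simp
  ring

lemma sinsq {n : ℕ} (hn : n ≠ 0) :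
    ∫ u in Set.Icc (0:ℝ) 1, 2 * sin (n * π * u) * sin (n * π * u) = 1 := by
  have hn' : (n:ℝ) ≠ 0 := by exact_mod_cast hn
  obtain ⟨a, ha⟩ : ∃ a : ℝ, a = n * π := ⟨_, rfl⟩
  have ha0 : a ≠ 0 := by rw [ha]; positivity
  have hsa : sin a = 0 := by rw [ha]; exact sin_nat_mul_pi n
  rw [← ha, integral_Icc_eq_integral_Ioc, ← intervalIntegral.integral_of_le zero_le_one]
  have hlin (u : ℝ) : HasDerivAt (fun u => a * u) a u := by
    simpa using (hasDerivAt_id u).const_mul a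
  have f1 : ∫ u in (0:ℝ)..1, 2 * sin (a * u) * sin (a * u) =
      (1 - sin (a * 1) * cos (a * 1) / a) - (0 - sin (a * 0) * cos (a * 0) / a) := by
    apply intervalIntegral.integral_eq_sub_of_hasDerivAt
      (f := fun u => u - sin (a * u) * cos (a * u) / a)
    · intro u _
      convert! (hasDerivAt_id u).sub ((((hlin u).sin).mul ((hlin u).cos)).div_const a) using 1
      field_simp
      linear_combination sin_sq_add_cos_sq (a * u)
    · apply Continuous.intervalIntegrable
      fun_prop
  rw [f1]
  simp [hsa]

/-- Lebesgue measure on the unit interval -/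
noncomputable def mu01 : Measure ℝ := volume.restrict (Set.Icc (0:ℝ) 1)

instance : IsProbabilityMeasure mu01 := ⟨by simp [mu01]⟩

lemma ae_mu01 : ∀ᵐ u ∂mu01, u ∈ Set.Icc (0:ℝ) 1 := ae_restrict_mem measurableSet_Icc

/-- Lebesgue measure on the unit cube -/
noncomputable def cube (k : ℕ) : Measure (Fin k → ℝ) := Measure.pi (fun _ => mu01)

instance (k : ℕ) : IsProbabilityMeasure (cube k) := by unfold cube; infer_instance

lemma cube_eq (k : ℕ) :
    (volume : Measure (Fin k → ℝ)).restrict (Set.univ.pi fun _ : Fin k => Set.Icc (0:ℝ) 1)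
      = cube k := by
  rw [volume_pi, Measure.restrict_pi_pi]; rfl

lemma cont_int {k : ℕ} {f : (Fin k → ℝ) → ℝ} (hf : Continuous f) : Integrable f (cube k) := by
  rw [← cube_eq]
  exact hf.continuousOn.integrableOn_compact (isCompact_univ_pi fun _ => isCompact_Icc)

lemma cube_succ {k : ℕ} {f : (Fin (k+1) → ℝ) → ℝ} (hf : Continuous f) :
    ∫ x, f x ∂(cube (k+1)) = ∫ u, ∫ x, f (Fin.cons u x) ∂(cube k) ∂mu01 := by
  have hp := (measurePreserving_piFinSuccAbove (fun _ : Fin (k+1) => mu01) 0).symm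
  have h1 := hp.integral_comp (MeasurableEquiv.measurableEmbedding _) f
  have h2 := (hp.integrable_comp_emb (MeasurableEquiv.measurableEmbedding _) (g := f)).2
    (cont_int hf)
  have h3 := integral_prod _ h2
  refine h1.symm.trans (h3.trans ?_)
  have h4 (u : ℝ) (x : Fin k → ℝ) :
      (MeasurableEquiv.piFinSuccAbove (fun _ : Fin (k+1) => ℝ) 0).symm (u, x) = Fin.cons u x := by
    simp [MeasurableEquiv.piFinSuccAbove]
    rfl
  simp only [Function.comp, h4]
  rfl

/-- chain product -/
noncomputable def chain (m : ℕ) (s t : ℝ) (x : Fin m → ℝ) : ℝ :=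
  ∏ i : Fin (m+1), Mker ((Fin.cons s x : Fin (m+1) → ℝ) i) ((Fin.snoc x t : Fin (m+1) → ℝ) i)

lemma chain_cont (m : ℕ) (s t : ℝ) : Continuous (chain m s t) := by
  unfold chain
  refine continuous_finsetProd _ fun i _ => ?_
  refine Mker_cont.comp (Continuous.prodMk ?_ ?_)
  · have h : ∀ i : Fin (m+1), Continuous (fun x : Fin m → ℝ => (Fin.cons s x : Fin (m+1) → ℝ) i) := by
      intro i
      induction i using Fin.cases with
      | zero => simpa only [Fin.cons_zero] using continuous_const
      | succ j => simpa only [Fin.cons_succ] using continuous_apply j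
    exact h i
  · have h : ∀ i : Fin (m+1), Continuous (fun x : Fin m → ℝ => (Fin.snoc x t : Fin (m+1) → ℝ) i) := by
      intro i
      induction i using Fin.lastCases with
      | last => simpa only [Fin.snoc_last] using continuous_const
      | cast j => simpa only [Fin.snoc_castSucc] using continuous_apply j
    exact h i

lemma chain_succ (m : ℕ) (s t u : ℝ) (x : Fin m → ℝ) :
    chain (m+1) s t (Fin.cons u x) = Mker s u * chain m u t x := by
  unfold chain
  rw [Fin.prod_univ_succ, ← Fin.cons_snoc_eq_snoc_cons]
  simp

lemma lam_summable (m : ℕ) : Summable (fun n => lam n ^ (m+1)) := by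
  have : Summable (fun n : ℕ => (2 / π^2)^(m+1) * (1 / (n:ℝ)^(2*(m+1)))) :=
    (Real.summable_one_div_nat_pow.2 (by omega)).mul_left _
  refine this.congr fun n => ?_
  rw [lam, pow_mul, ← one_div_pow, ← mul_pow]
  congr 1
  rw [div_mul_div_comm, mul_one, mul_comm]

lemma sin2_bound (a b : ℝ) : |2 * sin a * sin b| ≤ 2 := by
  rw [abs_mul, abs_mul, abs_two]
  have := abs_sin_le_one a
  have := abs_sin_le_one b
  have := abs_nonneg (sin a)
  have := abs_nonneg (sin b)
  nlinarith

lemma chain_sum (m : ℕ) {s t : ℝ} (hs : s ∈ Set.Icc (0:ℝ) 1) (ht : t ∈ Set.Icc (0:ℝ) 1) :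
    HasSum (fun n : ℕ => lam n ^ (m+1) * (2 * sin (n * π * s) * sin (n * π * t)))
      (∫ x, chain m s t x ∂(cube m)) := by
  induction m generalizing s with
  | zero =>
    have : ∀ x, chain 0 s t x = Mker s t := fun x => by simp [chain, Fin.snoc]
    simpa [this] using mercer hs ht
  | succ m ih =>
    rw [cube_succ (chain_cont _ _ _)]
    simp only [chain_succ, integral_const_mul]
    have key := hasSum_integral_of_dominated_convergence (μ := mu01)
      (F := fun (n : ℕ) u => Mker s u *
        (lam n ^ (m+1) * (2 * sin (n * π * u) * sin (n * π * t))))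
      (f := fun u => Mker s u * ∫ x, chain m u t x ∂(cube m))
      (fun n _ => 2 * (lam n ^ (m+1) * 2)) ?_ ?_ ?_ ?_ ?_
    · convert! key using 1
      ext n
      rcases eq_or_ne n 0 with rfl | hn
      · simp
      · have := eigen hs hn
        change ∫ u, _ ∂mu01 = _ at this
        rw [show (fun u => Mker s u * (lam n ^ (m+1) * (2 * sin (n * π * u) * sin (n * π * t))))
          = fun u => (lam n ^ (m+1) * 2 * sin (n * π * t)) * (Mker s u * sin (n * π * u)) by
            ext u; ring, integral_const_mul, this]
        ring
    · intro n
      apply Continuous.aestronglyMeasurable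
      unfold Mker
      fun_prop
    · intro n
      filter_upwards [ae_mu01] with u hu
      rw [norm_mul, norm_mul, Real.norm_eq_abs, Real.norm_eq_abs, Real.norm_eq_abs,
        abs_of_nonneg (pow_nonneg (lam_nonneg n) _)]
      gcongr
      · exact mul_nonneg (pow_nonneg (lam_nonneg n) _) (abs_nonneg _)
      · exact Mker_bound hs hu
      · exact pow_nonneg (lam_nonneg n) _
      · exact sin2_bound _ _
    · exact Filter.Eventually.of_forall fun _ => ((lam_summable m).mul_right 2).mul_left 2
    · exact integrable_const _
    · filter_upwards [ae_mu01] with u hu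
      exact (ih hu).mul_left _

lemma trace_sum (m : ℕ) :
    HasSum (fun n : ℕ => lam n ^ (m+1))
      (∫ s, ∫ x, chain m s s x ∂(cube m) ∂mu01) := by
  have key := hasSum_integral_of_dominated_convergence (μ := mu01)
      (F := fun (n : ℕ) u =>
        (lam n ^ (m+1) * (2 * sin (n * π * u) * sin (n * π * u))))
      (f := fun u => ∫ x, chain m u u x ∂(cube m))
      (fun n _ => (lam n ^ (m+1) * 2)) ?_ ?_ ?_ ?_ ?_
  · convert! key using 1
    ext n
    rcases eq_or_ne n 0 with rfl | hn
    · simp [lam]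
    · have := sinsq hn
      change ∫ u, _ ∂mu01 = _ at this
      rw [integral_const_mul, this, mul_one]
  · intro n
    apply Continuous.aestronglyMeasurable
    fun_prop
  · intro n
    filter_upwards [ae_mu01] with u hu
    rw [norm_mul, Real.norm_eq_abs, Real.norm_eq_abs,
      abs_of_nonneg (pow_nonneg (lam_nonneg n) _)]
    gcongr
    · exact pow_nonneg (lam_nonneg n) _
    · exact sin2_bound _ _
  · exact Filter.Eventually.of_forall fun _ => ((lam_summable m).mul_right 2)
  · exact integrable_const _
  · filter_upwards [ae_mu01] with u hu
    exact chain_sum m hu hu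

lemma cyc_eq (m : ℕ) (s : ℝ) (x : Fin m → ℝ) :
    ∏ i : Fin (m+1), Mker ((Fin.cons s x : Fin (m+1) → ℝ) i)
      ((Fin.cons s x : Fin (m+1) → ℝ) ⟨((i : ℕ) + 1) % (m+1), Nat.mod_lt _ i.pos⟩)
      = chain m s s x := by
  unfold chain
  refine Finset.prod_congr rfl fun i _ => ?_
  congr 1
  refine Fin.lastCases ?_ (fun j => ?_) i
  · have : (⟨((Fin.last m : ℕ) + 1) % (m+1), Nat.mod_lt _ (Fin.last m).pos⟩ : Fin (m+1)) = 0 := by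
      ext; simp
    rw [this]; simp
  · have : (⟨((j.castSucc : ℕ) + 1) % (m+1), Nat.mod_lt _ j.castSucc.pos⟩ : Fin (m+1))
        = j.succ := by
      ext; simp
    rw [this]; simp

/-- The cyclic iterated integral `∫_{[0,1]^k} M(t₁,t₂)⋯M(t_k,t₁) dt₁⋯dt_k`, i.e. the trace of
the k-th power of the integral operator with kernel `M`, equals `(2/π²)^k · ζ(2k)`. -/
theorem cyclic_trace_Mker (k : ℕ) (hk : 1 ≤ k) :
    ((∫ t in (Set.univ.pi fun _ : Fin k => Set.Icc (0:ℝ) 1),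
        ∏ i : Fin k, Mker (t i) (t ⟨((i : ℕ) + 1) % k, Nat.mod_lt _ i.pos⟩)) : ℂ)
      = ((2 / Real.pi ^ 2 : ℝ) : ℂ) ^ k * riemannZeta (2 * k) := by
  obtain ⟨m, rfl⟩ : ∃ m, k = m + 1 := ⟨k - 1, by omega⟩
  have hcont : Continuous (fun t : Fin (m+1) → ℝ => ∏ i : Fin (m+1), Mker (t i)
      (t ⟨((i : ℕ) + 1) % (m+1), Nat.mod_lt _ i.pos⟩)) := by
    unfold Mker; fun_prop
  have h1 := cube_succ hcont
  simp only [cyc_eq] at h1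
  have h2 := trace_sum m
  rw [← h1] at h2
  have h3 := zeta_nat_eq_tsum_of_gt_one (k := 2 * (m+1)) (by omega)
  rw [cube_eq]
  simp only [← Complex.ofReal_prod, integral_complex_ofReal]
  rw [← h2.tsum_eq, show (2 * ((m+1 : ℕ) : ℂ)) = ((2 * (m+1) : ℕ) : ℂ) by push_cast; rfl, h3,
    Complex.ofReal_tsum, ← tsum_mul_left]
  congr 1
  ext n
  rw [pow_mul, ← one_div_pow, ← mul_pow, lam]
  push_cast
  congr 1
  rw [div_mul_div_comm, mul_one, mul_comm]
end

section
/- Let f : [0,1] → ℝ be continuous. For each integer k ≥ 1 set A_k(f) = Σ_{n=0}^∞ (n+1)^{−2k} · ∫₀¹ f(t) · 2·sin²((n+1)·π·t) dt. Then lim_{k→∞} A_k(f)/ζ(2k) = ∫₀¹ f(t) · 2·sin²(π·t) dt. -/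
open MeasureTheory Real Filter

lemma aux_tendsto (c : ℕ → ℝ) (C : ℝ) (hc : ∀ n, |c n| ≤ C) :
    Tendsto (fun k : ℕ => ∑' n : ℕ, ((1 : ℝ) / ((n : ℝ) + 1) ^ (2 * k)) * c n) atTop
      (nhds (c 0)) := by
  have hC : 0 ≤ C := (abs_nonneg _).trans (hc 0)
  have hs : Summable (fun n : ℕ => (1 : ℝ) / ((n : ℝ) + 1) ^ 2 * C) := by
    have h := (summable_nat_add_iff 1).mpr (Real.summable_one_div_nat_pow.mpr (one_lt_two))
    refine Summable.mul_right C ?_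
    simpa using h
  have key := tendsto_tsum_of_dominated_convergence (𝓕 := atTop)
    (f := fun (k : ℕ) (n : ℕ) => ((1 : ℝ) / ((n : ℝ) + 1) ^ (2 * k)) * c n)
    (g := fun n : ℕ => if n = 0 then c 0 else 0) hs ?_ ?_
  · rwa [tsum_ite_eq] at key
  · intro n
    rcases Nat.eq_zero_or_pos n with rfl | hn
    · simp
    · have hn' : (1 : ℝ) ≤ n := by exact_mod_cast hn
      have h1 : Tendsto (fun k : ℕ => (((1 : ℝ) / ((n : ℝ) + 1) ^ 2)) ^ k) atTop (nhds 0) := by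
        apply tendsto_pow_atTop_nhds_zero_of_lt_one (by positivity)
        rw [div_lt_one (by positivity)]
        nlinarith
      have h2 := h1.mul_const (c n)
      rw [if_neg hn.ne']
      simpa [pow_mul] using h2
  · filter_upwards [eventually_ge_atTop 1] with k hk n
    rw [norm_mul, Real.norm_eq_abs, Real.norm_eq_abs, abs_of_nonneg (by positivity)]
    have h1 : (1 : ℝ) ≤ (n : ℝ) + 1 := by linarith [(Nat.cast_nonneg n : (0 : ℝ) ≤ n)]
    have h2 : ((n : ℝ) + 1) ^ 2 ≤ ((n : ℝ) + 1) ^ (2 * k) := pow_le_pow_right₀ h1 (by omega)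
    exact mul_le_mul (one_div_le_one_div_of_le (by positivity) h2) (hc n) (abs_nonneg _)
      (by positivity)

/-- Large-genus limit of the distribution of a single Wilson loop coordinate: with
`A_k(f) = Σₙ (n+1)^{−2k} ∫₀¹ f(t)·2sin²((n+1)πt) dt`, one has
`lim_{k→∞} A_k(f)/ζ(2k) = ∫₀¹ f(t)·2sin²(πt) dt`. -/
theorem wilson_loop_large_genus_limit (f : ℝ → ℝ) (hf : ContinuousOn f (Set.Icc 0 1)) :
    Tendsto (fun k : ℕ =>
        ((∑' n : ℕ, ((1 : ℝ) / ((n : ℝ) + 1) ^ (2 * k)) *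
            ∫ t in (0:ℝ)..1, f t * (2 * Real.sin (((n : ℝ) + 1) * π * t) ^ 2) : ℝ) : ℂ)
          / riemannZeta (2 * k))
      atTop
      (nhds (((∫ t in (0:ℝ)..1, f t * (2 * Real.sin (π * t) ^ 2) : ℝ) : ℂ))) := by
  obtain ⟨M, hM⟩ := isCompact_Icc.exists_bound_of_continuousOn hf
  have h1 := aux_tendsto
    (fun n => ∫ t in (0:ℝ)..1, f t * (2 * Real.sin (((n : ℝ) + 1) * π * t) ^ 2)) (M * 2) (by
      intro n
      have := intervalIntegral.norm_integral_le_of_norm_le_const (a := (0:ℝ)) (b := 1)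
        (C := M * 2) (f := fun t => f t * (2 * Real.sin (((n : ℝ) + 1) * π * t) ^ 2)) (by
          intro t ht
          rw [Set.uIoc_of_le zero_le_one] at ht
          have hm := hM t ⟨ht.1.le, ht.2⟩
          rw [norm_mul]
          refine mul_le_mul hm ?_ (norm_nonneg _) ((norm_nonneg _).trans hm)
          rw [Real.norm_eq_abs, abs_of_nonneg (by positivity)]
          linarith [Real.sin_sq_le_one (((n : ℝ) + 1) * π * t)])
      simpa using this)
  have h2 := aux_tendsto (fun _ => 1) 1 (by simp)
  have h3 := h1.div h2 one_ne_zero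
  have h4 := (Complex.continuous_ofReal.tendsto _).comp h3
  have e : (∫ t in (0:ℝ)..1, f t * (2 * Real.sin ((((0 : ℕ) : ℝ) + 1) * π * t) ^ 2)) / 1
      = ∫ t in (0:ℝ)..1, f t * (2 * Real.sin (π * t) ^ 2) := by simp
  rw [e] at h4
  refine h4.congr' ?_
  filter_upwards [eventually_ge_atTop 1] with k hk
  have hz : riemannZeta (2 * k)
      = ((∑' n : ℕ, ((1 : ℝ) / ((n : ℝ) + 1) ^ (2 * k)) * 1 : ℝ) : ℂ) := by
    have hre : 1 < ((2 * k : ℕ) : ℂ).re := by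
      rw [Complex.natCast_re]
      exact_mod_cast (by omega : 1 < 2 * k)
    have := zeta_eq_tsum_one_div_nat_add_one_cpow hre
    simp only [Complex.cpow_natCast] at this
    push_cast at this ⊢
    simpa using this
  rw [hz, ← Complex.ofReal_div]
  rfl
end

section
/- For every continuous function f : [0,1] → ℝ, ∫_𝒫 f(t₁) dt₁ dt₂ dt₃ = ∫₀¹ f(t) · 2·t·(1−t) dt. Consequently, since the volume of 𝒫 is 1/3, the normalized integral (1/vol(𝒫))·∫_𝒫 f(t₁) equals ∫₀¹ f(t)·6·(t−t²) dt. -/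
open MeasureTheory

lemma tri_abs (a : ℝ) (h0 : 0 ≤ a) (h1 : a ≤ 1) :
    ∫ y in (0:ℝ)..1, |y - a| = (a ^ 2 + (1 - a) ^ 2) / 2 := by
  have hi : ∀ u v : ℝ, IntervalIntegrable (fun y : ℝ => |y - a|) volume u v := fun u v =>
    (by fun_prop : Continuous fun y : ℝ => |y - a|).intervalIntegrable u v
  rw [← intervalIntegral.integral_add_adjacent_intervals (hi 0 a) (hi a 1)]
  have e1 : ∫ y in (0:ℝ)..a, |y - a| = ∫ y in (0:ℝ)..a, (a - y) := by
    apply intervalIntegral.integral_congr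
    intro y hy
    rw [Set.uIcc_of_le h0] at hy
    simp only
    rw [abs_of_nonpos (by linarith [hy.2])]; ring
  have e2 : ∫ y in a..1, |y - a| = ∫ y in a..1, (y - a) := by
    apply intervalIntegral.integral_congr
    intro y hy
    rw [Set.uIcc_of_le h1] at hy
    simp only
    rw [abs_of_nonneg (by linarith [hy.1])]
  rw [e1, e2, intervalIntegral.integral_sub (by simp) (by simp),
    intervalIntegral.integral_sub (by simp) (by simp)]
  simp
  ring

lemma tri_closed : IsClosed trinion := by
  have : trinion = {p : ℝ × ℝ × ℝ | 0 ≤ p.1} ∩ {p | p.1 ≤ 1} ∩ {p | 0 ≤ p.2.1} ∩ {p | p.2.1 ≤ 1}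
      ∩ {p | 0 ≤ p.2.2} ∩ {p | p.2.2 ≤ 1} ∩ {p | p.1 + p.2.1 + p.2.2 ≤ 2}
      ∩ {p | |p.2.1 - p.2.2| ≤ p.1} ∩ {p | p.1 ≤ p.2.1 + p.2.2} := by
    ext p
    simp only [trinion, Set.mem_ofPred_eq, Set.mem_inter_iff, Set.mem_Icc]
    tauto
  rw [this]
  refine IsClosed.inter (IsClosed.inter (IsClosed.inter (IsClosed.inter (IsClosed.inter
    (IsClosed.inter (IsClosed.inter (IsClosed.inter ?_ ?_) ?_) ?_) ?_) ?_) ?_) ?_) ?_ <;>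
  exact isClosed_le (by fun_prop) (by fun_prop)

lemma tri_compact : IsCompact trinion := by
  refine IsCompact.of_isClosed_subset (isCompact_Icc (α := ℝ)|>.prod
    ((isCompact_Icc (α := ℝ)).prod (isCompact_Icc (α := ℝ)))) tri_closed
      (s := Set.Icc (0:ℝ) 1 ×ˢ Set.Icc (0:ℝ) 1 ×ˢ Set.Icc (0:ℝ) 1) ?_
  intro p hp
  exact ⟨hp.1, hp.2.1, hp.2.2.1⟩

lemma tri_slice (t : ℝ) (ht : t ∈ Set.Icc (0:ℝ) 1) :
    volume.real (Prod.mk t ⁻¹' trinion) = 2 * t * (1 - t) := by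
  obtain ⟨h0, h1⟩ := ht
  have hm : MeasurableSet (Prod.mk t ⁻¹' trinion) :=
    measurable_prodMk_left tri_closed.measurableSet
  have hs : ∀ y : ℝ, volume (Prod.mk y ⁻¹' (Prod.mk t ⁻¹' trinion)) =
      (Set.Icc (0:ℝ) 1).indicator
        (fun y => ENNReal.ofReal (1 - |y - (1 - t)| - |y - t|)) y := by
    intro y
    by_cases hy : y ∈ Set.Icc (0:ℝ) 1
    · rw [Set.indicator_of_mem hy, ← Real.volume_Icc]
      congr 1
      ext z
      obtain ⟨hy0, hy1⟩ := hy
      simp only [trinion, Set.mem_preimage, Set.mem_ofPred_eq, Set.mem_Icc]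
      constructor
      · rintro ⟨-, -, ⟨hz0, hz1⟩, h2, h3, h4⟩
        rw [abs_le] at h3
        constructor
        · rw [abs_le]; constructor <;> linarith
        · have : |y - (1 - t)| ≤ 1 - z := by rw [abs_le]; constructor <;> linarith
          linarith
      · rintro ⟨h2, h3⟩
        have h3' : |y - (1 - t)| ≤ 1 - z := by linarith
        have := abs_nonneg (y - t)
        have := abs_nonneg (y - (1 - t))
        rw [abs_le] at h2 h3'
        refine ⟨⟨h0, h1⟩, ⟨hy0, hy1⟩, ⟨by linarith, by linarith⟩, by linarith, ?_, by linarith⟩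
        rw [abs_le]; constructor <;> linarith
    · rw [Set.indicator_of_notMem hy]
      convert measure_empty (μ := (volume : Measure ℝ))
      ext z
      simp only [trinion, Set.mem_preimage, Set.mem_ofPred_eq, Set.mem_empty_iff_false, iff_false]
      exact fun h => hy h.2.1
  have hnn : ∀ y ∈ Set.Icc (0:ℝ) 1, 0 ≤ 1 - |y - (1 - t)| - |y - t| := by
    rintro y ⟨hy0, hy1⟩
    rcases abs_cases (y - (1 - t)) with h | h <;> rcases abs_cases (y - t) with h' | h' <;>
      linarith
  have hc : ∀ a : ℝ, Continuous fun y : ℝ => |y - a| := fun a => by fun_prop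
  rw [Measure.real, Measure.volume_eq_prod, Measure.prod_apply hm]
  simp_rw [hs]
  rw [lintegral_indicator measurableSet_Icc, ← ofReal_integral_eq_lintegral_ofReal]
  · rw [ENNReal.toReal_ofReal (setIntegral_nonneg measurableSet_Icc hnn),
      integral_Icc_eq_integral_Ioc, ← intervalIntegral.integral_of_le zero_le_one,
      intervalIntegral.integral_sub, intervalIntegral.integral_sub, tri_abs _ h0 h1,
      tri_abs (1 - t) (by linarith) (by linarith)]
    · simp; ring
    all_goals exact Continuous.intervalIntegrable (by fun_prop) _ _
  · exact (Continuous.continuousOn (by fun_prop)).integrableOn_compact isCompact_Icc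
  · exact (ae_restrict_iff' measurableSet_Icc).2 (Filter.Eventually.of_forall hnn)

lemma tri_main (f : ℝ → ℝ) (hf : ContinuousOn f (Set.Icc 0 1)) :
    (∫ p in trinion, f p.1) = (∫ t in (0:ℝ)..1, f t * (2 * t * (1 - t))) := by
  have hmT := tri_closed.measurableSet
  have hi : IntegrableOn (fun p : ℝ × ℝ × ℝ => f p.1) trinion :=
    (hf.comp continuous_fst.continuousOn (fun p hp => hp.1)).integrableOn_compact tri_compact
  rw [← integral_indicator hmT]
  rw [← integrable_indicator_iff hmT] at hi
  rw [Measure.volume_eq_prod] at hi ⊢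
  rw [integral_prod _ hi, intervalIntegral.integral_of_le zero_le_one,
    ← integral_Icc_eq_integral_Ioc, ← integral_indicator measurableSet_Icc]
  congr 1
  ext t
  have e : (fun q : ℝ × ℝ => trinion.indicator (fun p => f p.1) (t, q)) =
      (Prod.mk t ⁻¹' trinion).indicator (fun _ => f t) := by
    ext q; simp only [Set.indicator]; rfl
  rw [e, integral_indicator_const _ (measurable_prodMk_left hmT)]
  by_cases ht : t ∈ Set.Icc (0:ℝ) 1
  · rw [Set.indicator_of_mem ht, tri_slice t ht, smul_eq_mul, mul_comm]
  · rw [Set.indicator_of_notMem ht]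
    have : Prod.mk t ⁻¹' trinion = ∅ := by
      ext q
      simp only [Set.mem_preimage, Set.mem_empty_iff_false, iff_false]
      exact fun h => ht h.1
    simp [this]

lemma tri_vol : (volume trinion).toReal = 1 / 3 := by
  have h := tri_main (fun _ => 1) continuousOn_const
  have e : ∫ t in (0:ℝ)..1, (1:ℝ) * (2 * t * (1 - t)) = 1 / 3 := by
    have : (fun t : ℝ => (1:ℝ) * (2 * t * (1 - t))) = fun t => 2 * t - 2 * t ^ 2 := by
      ext t; ring
    rw [this, intervalIntegral.integral_sub, intervalIntegral.integral_const_mul,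
      intervalIntegral.integral_const_mul, integral_id, integral_pow]
    · norm_num
    all_goals exact Continuous.intervalIntegrable (by fun_prop) _ _
  rw [e] at h
  simpa [Measure.real] using h

/-- `∫_𝒫 f(t₁) = ∫₀¹ f(t)·2t(1−t) dt`, and, since `vol(𝒫) = 1/3`, the normalized integral is
`∫₀¹ f(t)·6(t−t²) dt`. -/
theorem trinion_marginal (f : ℝ → ℝ) (hf : ContinuousOn f (Set.Icc 0 1)) :
    (∫ p in trinion, f p.1) = (∫ t in (0:ℝ)..1, f t * (2 * t * (1 - t))) ∧
    (∫ p in trinion, f p.1) / (volume trinion).toReal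
      = ∫ t in (0:ℝ)..1, f t * (6 * (t - t ^ 2)) := by
  refine ⟨tri_main f hf, ?_⟩
  rw [tri_main f hf, tri_vol, ← intervalIntegral.integral_div]
  congr 1
  ext t
  ring
end

section
/- For every integer k ≥ 1 and every t ∈ [0,1], 2·Σ_{n=0}^∞ sin²((n+1)·π·t)/(n+1)^{2k} = ζ(2k)·(1 − B_{2k}(t)/B_{2k}(0)), where B_{2k} is the 2k-th Bernoulli polynomial and B_{2k}(0) is the 2k-th Bernoulli number (which is nonzero). -/
open Real

/-- For `k ≥ 1` and `t ∈ [0,1]`: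
`2·Σₙ sin²((n+1)πt)/(n+1)^{2k} = ζ(2k)·(1 − B_{2k}(t)/B_{2k}(0))`, where `B_{2k}` is the
`2k`-th Bernoulli polynomial and `B_{2k}(0)` is the `2k`-th Bernoulli number, which is nonzero. -/
theorem sine_sum_bernoulli (k : ℕ) (hk : 1 ≤ k) (t : ℝ) (ht : t ∈ Set.Icc (0:ℝ) 1) :
    (Polynomial.aeval (0 : ℝ) (Polynomial.bernoulli (2 * k))) ≠ 0 ∧
    ((2 * ∑' n : ℕ, Real.sin (((n : ℝ) + 1) * π * t) ^ 2 / ((n : ℝ) + 1) ^ (2 * k) : ℝ) : ℂ)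
      = riemannZeta (2 * k) *
          (1 - ((Polynomial.aeval t (Polynomial.bernoulli (2 * k)) : ℝ) : ℂ)
                / ((Polynomial.aeval (0 : ℝ) (Polynomial.bernoulli (2 * k)) : ℝ) : ℂ)) := by
  have hk0 : k ≠ 0 := by omega
  have H := hasSum_one_div_nat_pow_mul_cos hk0 ht
  have H0 := hasSum_one_div_nat_pow_mul_cos hk0 (Set.left_mem_Icc.mpr (zero_le_one' ℝ))
  simp only [mul_zero, Real.cos_zero, mul_one, Polynomial.eval_map_algebraMap] at H H0
  set c : ℝ := (-1 : ℝ) ^ (k + 1) * (2 * π) ^ (2 * k) / 2 / ((2 * k).factorial : ℝ) with hc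
  set b0 : ℝ := Polynomial.aeval (0 : ℝ) (Polynomial.bernoulli (2 * k)) with hb0
  set b : ℝ := Polynomial.aeval t (Polynomial.bernoulli (2 * k)) with hb
  have hpos : 0 < c * b0 := by
    rw [← H0.tsum_eq]
    exact H0.summable.tsum_pos (fun n => by positivity) 1 (by simp)
  have hbne : b0 ≠ 0 := right_ne_zero_of_mul hpos.ne'
  refine ⟨hbne, ?_⟩
  have hz : riemannZeta (2 * k) = ((c * b0 : ℝ) : ℂ) := by
    have := zeta_nat_eq_tsum_of_gt_one (k := 2 * k) (by omega)
    push_cast at this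
    rw [this, ← H0.tsum_eq]
    push_cast
    rfl
  have H1 := (hasSum_nat_add_iff' 1).mpr (H0.sub H)
  have h2 : 2 * ∑' n : ℕ, Real.sin (((n : ℝ) + 1) * π * t) ^ 2 / ((n : ℝ) + 1) ^ (2 * k)
      = c * b0 - c * b := by
    rw [← tsum_mul_left]
    have e : c * b0 - c * b = c * b0 - c * b - ∑ i ∈ Finset.range 1,
        (1 / (i : ℝ) ^ (2 * k) - 1 / (i : ℝ) ^ (2 * k) * Real.cos (2 * π * i * t)) := by
      simp
    rw [e, ← H1.tsum_eq]
    refine tsum_congr fun n => ?_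
    push_cast
    have : 2 * π * ((n : ℝ) + 1) * t = 2 * (((n : ℝ) + 1) * π * t) := by ring
    rw [this, Real.cos_two_mul, Real.sin_sq]
    ring
  rw [h2, hz]
  have : (b0 : ℂ) ≠ 0 := by exact_mod_cast hbne
  push_cast
  field_simp
end

section
/- For every p ∈ ℕ and every real u, (2·cos u)^p · sin u = Σ_{k=0}^{⌊p/2⌋} (C(p,k) − C(p,k−1)) · sin((p−2k+1)·u), where C(p,k) denotes the binomial coefficient and C(p,−1) = 0. Equivalently, whenever sin u ≠ 0, χ̂₁(u)^p = Σ_{k=0}^{⌊p/2⌋} N_{p,k}·χ̂_{p−2k}(u) with multiplicities N_{p,k} = C(p,k) − C(p,k−1). -/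
noncomputable def mulN (p k : ℕ) : ℝ :=
  (p.choose k : ℝ) - (if k = 0 then 0 else (p.choose (k - 1) : ℝ))

lemma mulN_succ (p k : ℕ) : mulN (p + 1) (k + 1) = mulN p (k + 1) + mulN p k := by
  unfold mulN
  rcases k with _ | k
  · simp
  · simp [Nat.choose_succ_succ]
    ring

lemma two_cos_step (p k : ℕ) (x : ℝ) :
    2 * Real.cos x * Real.sin (((p : ℝ) - 2 * (k : ℝ) + 1) * x)
      = Real.sin ((((p + 1 : ℕ) : ℝ) - 2 * (k : ℝ) + 1) * x)
        + Real.sin ((((p + 1 : ℕ) : ℝ) - 2 * ((k + 1 : ℕ) : ℝ) + 1) * x) := by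
  have h1 : (((p + 1 : ℕ) : ℝ) - 2 * (k : ℝ) + 1) * x
      = ((p : ℝ) - 2 * (k : ℝ) + 1) * x + x := by push_cast; ring
  have h2 : (((p + 1 : ℕ) : ℝ) - 2 * ((k + 1 : ℕ) : ℝ) + 1) * x
      = ((p : ℝ) - 2 * (k : ℝ) + 1) * x - x := by push_cast; ring
  rw [h1, h2, Real.sin_add, Real.sin_sub]
  ring

lemma two_cos_sum (p m : ℕ) (x : ℝ) :
    2 * Real.cos x * ∑ k ∈ Finset.range (m + 1),
        mulN p k * Real.sin (((p : ℝ) - 2 * (k : ℝ) + 1) * x)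
      = ∑ k ∈ Finset.range (m + 1),
        mulN (p + 1) k * Real.sin ((((p + 1 : ℕ) : ℝ) - 2 * (k : ℝ) + 1) * x)
        + mulN p m * Real.sin ((((p + 1 : ℕ) : ℝ) - 2 * ((m + 1 : ℕ) : ℝ) + 1) * x) := by
  induction m with
  | zero =>
    have h := two_cos_step p 0 x
    have h0 : mulN p 0 = 1 := by simp [mulN]
    have h1 : mulN (p + 1) 0 = 1 := by simp [mulN]
    simp only [zero_add, Finset.sum_range_one, h0, h1, one_mul] at h ⊢
    exact h
  | succ m ih =>
    rw [Finset.sum_range_succ, mul_add, ih, Finset.sum_range_succ _ (m + 1), mulN_succ]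
    linear_combination mulN p (m + 1) * two_cos_step p (m + 1) x

/-- Decomposition of the `p`-th power of the defining character of `SU(2)`:
`(2cos u)^p · sin u = Σ_{k=0}^{⌊p/2⌋} (C(p,k) − C(p,k−1)) · sin((p−2k+1)u)`, with
the convention `C(p,−1) = 0`. -/
theorem pow_two_cos_mul_sin (p : ℕ) (x : ℝ) :
    (2 * Real.cos x) ^ p * Real.sin x
      = ∑ k ∈ Finset.range (p / 2 + 1),
          ((p.choose k : ℝ) - (if k = 0 then 0 else (p.choose (k - 1) : ℝ)))
            * Real.sin (((p : ℝ) - 2 * (k : ℝ) + 1) * x) := by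
  change _ = ∑ k ∈ Finset.range (p / 2 + 1),
    mulN p k * Real.sin (((p : ℝ) - 2 * (k : ℝ) + 1) * x)
  induction p with
  | zero => simp [mulN]
  | succ p ih =>
    rw [pow_succ', mul_assoc, ih, two_cos_sum]
    rcases Nat.even_or_odd' p with ⟨m, h | h⟩
    · have e1 : p / 2 = m := by omega
      have e2 : (p + 1) / 2 = m := by omega
      rw [e1, e2]
      have : (((p + 1 : ℕ) : ℝ) - 2 * ((m + 1 : ℕ) : ℝ) + 1) * x = 0 := by
        rw [h]; push_cast; ring
      rw [this]; simp
    · have e1 : p / 2 = m := by omega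
      have e2 : (p + 1) / 2 = m + 1 := by omega
      rw [e1, e2, Finset.sum_range_succ _ (m + 1), mulN_succ]
      have : mulN p (m + 1) = 0 := by
        simp [mulN, h, Nat.choose_symm_half]
      rw [this, zero_add]
end

section
/- For all p, q ∈ ℕ and every real c, ∫₀¹ u_p(t) · u_q(t) · exp(2c·cos(π·t)) dt = Σ_{j=0}^{min(p,q)} Σ_{k=0}^∞ (c^{L+2k}/(L+2k)!) · (C(L+2k,k) − C(L+2k,k−1)), where L = p+q−2j, C(·,·) is the binomial coefficient and C(m,−1) = 0. In particular the right-hand side is a convergent series of nonnegative terms when c ≥ 0. -/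
open MeasureTheory Real

/-- The `k`-th term of the series attached to the summand `L = p+q−2j` in the edge
contribution for the Wilson action: `(c^{L+2k}/(L+2k)!)·(C(L+2k,k) − C(L+2k,k−1))`, with the
convention `C(m,−1) = 0`. -/
noncomputable def wilsonEdgeTerm (p q j k : ℕ) (c : ℝ) : ℝ :=
  c ^ (p + q - 2 * j + 2 * k) / (Nat.factorial (p + q - 2 * j + 2 * k)) *
    ((Nat.choose (p + q - 2 * j + 2 * k) k : ℝ)
      - (if k = 0 then 0 else (Nat.choose (p + q - 2 * j + 2 * k) (k - 1) : ℝ)))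

noncomputable def bal (L k : ℕ) : ℝ :=
  (Nat.choose (L + 2 * k) k : ℝ) - (if k = 0 then 0 else (Nat.choose (L + 2 * k) (k - 1) : ℝ))

theorem bal_zero (L : ℕ) : bal L 0 = 1 := by simp [bal]

theorem bal_succ (L k : ℕ) : bal (L + 1) (k + 1) = bal L (k + 1) + bal (L + 2) k := by
  unfold bal
  have e1 : L + 1 + 2 * (k + 1) = (L + 2 * k + 2) + 1 := by ring
  have e2 : L + 2 * (k + 1) = L + 2 * k + 2 := by ring
  have e3 : L + 2 + 2 * k = L + 2 * k + 2 := by ring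
  rw [e1, e2, e3]
  cases k with
  | zero => simp [Nat.choose_succ_succ]; ring
  | succ m =>
    simp only [Nat.add_eq_zero_iff, one_ne_zero, and_false, if_false, Nat.add_sub_cancel]
    rw [Nat.choose_succ_succ' (L + 2 * (m + 1) + 2) (m + 1),
      Nat.choose_succ_succ' (L + 2 * (m + 1) + 2) m]
    push_cast
    ring

theorem bal_zero_succ (k : ℕ) : bal 0 (k + 1) = bal 1 k := by
  unfold bal
  have e1 : 0 + 2 * (k + 1) = (2 * k + 1) + 1 := by ring
  have e2 : 1 + 2 * k = 2 * k + 1 := by ring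
  rw [e1, e2]
  have hs : Nat.choose (2 * k + 1) (k + 1) = Nat.choose (2 * k + 1) k :=
    Nat.choose_symm_half k
  cases k with
  | zero => norm_num
  | succ m =>
    simp only [Nat.add_eq_zero_iff, one_ne_zero, and_false, if_false, Nat.add_sub_cancel]
    rw [Nat.choose_succ_succ' (2 * (m + 1) + 1) (m + 1),
      Nat.choose_succ_succ' (2 * (m + 1) + 1) m, hs]
    push_cast
    ring

theorem bal_nonneg (L k : ℕ) : 0 ≤ bal L k := by
  cases k with
  | zero => simp [bal_zero]
  | succ m =>
    unfold bal
    simp only [Nat.add_eq_zero_iff, one_ne_zero, and_false, if_false, Nat.add_sub_cancel]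
    rw [sub_nonneg, Nat.cast_le]
    exact Nat.choose_le_succ_of_lt_half_left (by omega)

noncomputable def mom (n L : ℕ) : ℝ :=
  ∫ t in (0:ℝ)..1, 2 * sin (π * t) * sin (((L : ℝ) + 1) * (π * t)) * (2 * cos (π * t)) ^ n

theorem int_cos (m : ℕ) (hm : m ≠ 0) : ∫ t in (0:ℝ)..1, cos ((m : ℝ) * (π * t)) = 0 := by
  have hm' : (m : ℝ) * π ≠ 0 := mul_ne_zero (Nat.cast_ne_zero.mpr hm) pi_ne_zero
  have : ∀ t : ℝ, (m : ℝ) * (π * t) = (m * π) * t := fun t => by ring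
  simp_rw [this]
  rw [intervalIntegral.integral_comp_mul_left (fun x => cos x) hm', integral_cos]
  simp [sin_nat_mul_pi]

theorem mom_zero (L : ℕ) : mom 0 L = if L = 0 then 1 else 0 := by
  unfold mom
  have : ∀ t : ℝ, 2 * sin (π * t) * sin (((L : ℝ) + 1) * (π * t)) * (2 * cos (π * t)) ^ 0
      = cos ((L : ℝ) * (π * t)) - cos (((L + 2 : ℕ) : ℝ) * (π * t)) := by
    intro t
    have h1 : (L : ℝ) * (π * t) = ((L : ℝ) + 1) * (π * t) - π * t := by ring
    have h2 : ((L + 2 : ℕ) : ℝ) * (π * t) = ((L : ℝ) + 1) * (π * t) + π * t := by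
      push_cast; ring
    rw [h1, h2, cos_sub, cos_add]; ring
  simp_rw [this]
  rw [intervalIntegral.integral_sub (Continuous.intervalIntegrable (by fun_prop) _ _)
    (Continuous.intervalIntegrable (by fun_prop) _ _), int_cos (L + 2) (by omega)]
  split_ifs with h
  · subst h; simp
  · rw [int_cos L h]; simp

theorem mom_succ_succ (n L : ℕ) : mom (n + 1) (L + 1) = mom n (L + 2) + mom n L := by
  unfold mom
  rw [← intervalIntegral.integral_add (Continuous.intervalIntegrable (by fun_prop) _ _)
    (Continuous.intervalIntegrable (by fun_prop) _ _)]
  congr 1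
  ext t
  have h1 : ((L : ℝ) + 1) * (π * t) = ((L : ℝ) + 2) * (π * t) - π * t := by ring
  have h2 : (((L + 2 : ℕ) : ℝ) + 1) * (π * t) = ((L : ℝ) + 2) * (π * t) + π * t := by
    push_cast; ring
  have h3 : (((L + 1 : ℕ) : ℝ) + 1) * (π * t) = ((L : ℝ) + 2) * (π * t) := by
    push_cast; ring
  rw [h1, h2, h3, sin_sub, sin_add]; ring

theorem mom_succ_zero (n : ℕ) : mom (n + 1) 0 = mom n 1 := by
  unfold mom
  congr 1
  ext t
  have h2 : (((1 : ℕ) : ℝ) + 1) * (π * t) = 2 * (π * t) := by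
    push_cast; ring
  rw [h2, sin_two_mul]; simp; ring

theorem mom_eq (n : ℕ) : ∀ L : ℕ, (∀ k, n = L + 2 * k → mom n L = bal L k) ∧
    ((∀ k, n ≠ L + 2 * k) → mom n L = 0) := by
  induction n with
  | zero =>
    intro L
    rw [mom_zero]
    constructor
    · intro k hk
      obtain rfl : k = 0 := by omega
      obtain rfl : L = 0 := by omega
      simp [bal_zero]
    · intro h
      have := h 0
      rw [if_neg (by omega)]
  | succ n ih =>
    intro L
    cases L with
    | zero =>
      rw [mom_succ_zero]
      constructor
      · intro k hk
        obtain ⟨m, rfl⟩ : ∃ m, k = m + 1 := ⟨k - 1, by omega⟩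
        rw [bal_zero_succ]
        exact (ih 1).1 m (by omega)
      · intro h
        exact (ih 1).2 fun k hk => h (k + 1) (by omega)
    | succ L =>
      rw [mom_succ_succ]
      constructor
      · intro k hk
        rw [(ih L).1 k (by omega)]
        cases k with
        | zero => rw [(ih (L + 2)).2 fun k hk => by omega, bal_zero, bal_zero, zero_add]
        | succ m => rw [(ih (L + 2)).1 m (by omega), bal_succ, add_comm]
      · intro h
        rw [(ih L).2 fun k hk => h k (by omega), (ih (L + 2)).2 fun k hk => h (k + 1) (by omega),
          add_zero]

theorem hasSum_mom (L : ℕ) (c : ℝ) :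
    HasSum (fun n : ℕ => c ^ n / (n.factorial : ℝ) * mom n L)
      (∫ t in (0:ℝ)..1, 2 * sin (π * t) * sin (((L : ℝ) + 1) * (π * t)) *
        exp (2 * c * cos (π * t))) := by
  have key := intervalIntegral.hasSum_integral_of_dominated_convergence
    (μ := volume) (a := (0:ℝ)) (b := 1)
    (F := fun (n : ℕ) (t : ℝ) => c ^ n / (n.factorial : ℝ) *
      (2 * sin (π * t) * sin (((L : ℝ) + 1) * (π * t)) * (2 * cos (π * t)) ^ n))
    (f := fun t => 2 * sin (π * t) * sin (((L : ℝ) + 1) * (π * t)) * exp (2 * c * cos (π * t)))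
    (fun n _ => 2 * ((2 * |c|) ^ n / (n.factorial : ℝ)))
    (fun n => Continuous.aestronglyMeasurable (by fun_prop))
    ?_ ?_ ?_ ?_
  · simp only [intervalIntegral.integral_const_mul] at key
    exact key
  · intro n
    refine Filter.Eventually.of_forall fun t _ => ?_
    have h1 := abs_sin_le_one (π * t)
    have h2 := abs_sin_le_one (((L : ℝ) + 1) * (π * t))
    have h3 := abs_cos_le_one (π * t)
    have h4 : |2 * cos (π * t)| ^ n ≤ 2 ^ n := by
      apply pow_le_pow_left₀ (abs_nonneg _)
      rw [abs_mul, abs_two]; linarith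
    have h5 : |sin (π * t)| * |sin (((L : ℝ) + 1) * (π * t))| ≤ 1 :=
      mul_le_one₀ h1 (abs_nonneg _) h2
    rw [norm_eq_abs, abs_mul, abs_div, abs_pow, abs_mul, abs_mul, abs_mul, abs_two, abs_pow,
      Nat.abs_cast, mul_pow]
    calc |c| ^ n / (n.factorial : ℝ) *
          (2 * |sin (π * t)| * |sin (((L : ℝ) + 1) * (π * t))| * |2 * cos (π * t)| ^ n)
        = |c| ^ n / (n.factorial : ℝ) * 2 *
          ((|sin (π * t)| * |sin (((L : ℝ) + 1) * (π * t))|) * |2 * cos (π * t)| ^ n) := by ring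
      _ ≤ |c| ^ n / (n.factorial : ℝ) * 2 * (1 * 2 ^ n) := by gcongr
      _ = _ := by ring
  · exact Filter.Eventually.of_forall fun t _ =>
      (Real.summable_pow_div_factorial (2 * |c|)).mul_left 2
  · exact intervalIntegrable_const
  · refine Filter.Eventually.of_forall fun t _ => ?_
    have h : HasSum (fun n : ℕ => (2 * c * cos (π * t)) ^ n / (n.factorial : ℝ))
        (exp (2 * c * cos (π * t))) := by
      rw [Real.exp_eq_exp_ℝ]
      exact NormedSpace.expSeries_div_hasSum_exp _
    refine (h.mul_left (2 * sin (π * t) * sin (((L : ℝ) + 1) * (π * t)))).congr_fun ?_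
    intro n
    rw [show 2 * c * cos (π * t) = c * (2 * cos (π * t)) by ring, mul_pow]
    ring

theorem hasSum_bal (L : ℕ) (c : ℝ) :
    HasSum (fun k : ℕ => c ^ (L + 2 * k) / ((L + 2 * k).factorial : ℝ) * bal L k)
      (∫ t in (0:ℝ)..1, 2 * sin (π * t) * sin (((L : ℝ) + 1) * (π * t)) *
        exp (2 * c * cos (π * t))) := by
  have hinj : Function.Injective (fun k : ℕ => L + 2 * k) := fun a b h => by
    simp only at h; omega
  have h := (hinj.hasSum_iff (f := fun n : ℕ => c ^ n / (n.factorial : ℝ) * mom n L) (by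
    intro n hn
    rw [(mom_eq n L).2 fun k hk => hn ⟨k, hk.symm⟩, mul_zero])).mpr (hasSum_mom L c)
  refine h.congr_fun ?_
  intro k
  simp only [Function.comp]
  rw [(mom_eq (L + 2 * k) L).1 k rfl]

theorem tele (s x : ℝ) (N : ℕ) :
    ∑ j ∈ Finset.range N, 2 * sin x * sin ((s - 2 * j + 1) * x)
      = cos ((s - 2 * N + 2) * x) - cos ((s + 2) * x) := by
  induction N with
  | zero => simp
  | succ N ih =>
    rw [Finset.sum_range_succ, ih]
    have h1 : (s - 2 * N + 2) * x = (s - 2 * N + 1) * x + x := by ring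
    have h2 : (s - 2 * ((N + 1 : ℕ) : ℝ) + 2) * x = (s - 2 * N + 1) * x - x := by push_cast; ring
    rw [h1, h2, cos_add, cos_sub]; ring

theorem u_mul (p q : ℕ) (t : ℝ) : u p t * u q t =
    ∑ j ∈ Finset.range (min p q + 1),
      2 * sin (π * t) * sin ((((p + q - 2 * j : ℕ) : ℝ) + 1) * (π * t)) := by
  have e : ∀ j ∈ Finset.range (min p q + 1),
      2 * sin (π * t) * sin ((((p + q - 2 * j : ℕ) : ℝ) + 1) * (π * t))
      = 2 * sin (π * t) * sin ((((p : ℝ) + q) - 2 * j + 1) * (π * t)) := by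
    intro j hj
    rw [Finset.mem_range] at hj
    rw [Nat.cast_sub (by omega)]
    push_cast
    rfl
  rw [Finset.sum_congr rfl e, tele]
  have hu : u p t * u q t = 2 * (sin (((p : ℝ) + 1) * (π * t)) * sin (((q : ℝ) + 1) * (π * t))) := by
    unfold u
    rw [mul_assoc _ π t, mul_assoc _ π t]
    linear_combination (sin (((p : ℝ) + 1) * (π * t)) * sin (((q : ℝ) + 1) * (π * t))) *
      Real.mul_self_sqrt (show (0:ℝ) ≤ 2 by norm_num)
  have h2 : ((p : ℝ) + q + 2) * (π * t) = ((p : ℝ) + 1) * (π * t) + ((q : ℝ) + 1) * (π * t) := by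
    ring
  rw [hu, h2]
  rcases le_total p q with h | h
  · rw [min_eq_left h]
    have h1 : ((p : ℝ) + q - 2 * ((p + 1 : ℕ) : ℝ) + 2) * (π * t)
        = ((q : ℝ) + 1) * (π * t) - ((p : ℝ) + 1) * (π * t) := by push_cast; ring
    rw [h1, cos_add, cos_sub]; ring
  · rw [min_eq_right h]
    have h1 : ((p : ℝ) + q - 2 * ((q + 1 : ℕ) : ℝ) + 2) * (π * t)
        = ((p : ℝ) + 1) * (π * t) - ((q : ℝ) + 1) * (π * t) := by push_cast; ring
    rw [h1, cos_add, cos_sub]; ring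

/-- Edge contribution with the Wilson action:
`∫₀¹ u_p(t)·u_q(t)·exp(2c·cos(πt)) dt = Σ_{j=0}^{min(p,q)} Σ_k (c^{L+2k}/(L+2k)!)·(C(L+2k,k) −
C(L+2k,k−1))` with `L = p+q−2j`; for `c ≥ 0` the inner series is convergent with nonnegative
terms. -/
theorem wilson_edge_contribution (p q : ℕ) (c : ℝ) :
    ((∫ t in (0:ℝ)..1, u p t * u q t * Real.exp (2 * c * Real.cos (π * t)))
        = ∑ j ∈ Finset.range (min p q + 1), ∑' k : ℕ, wilsonEdgeTerm p q j k c) ∧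
    (0 ≤ c → ∀ j ∈ Finset.range (min p q + 1),
        Summable (fun k : ℕ => wilsonEdgeTerm p q j k c) ∧
        ∀ k : ℕ, 0 ≤ wilsonEdgeTerm p q j k c) := by
  have hs : ∀ j, HasSum (fun k : ℕ => wilsonEdgeTerm p q j k c)
      (∫ t in (0:ℝ)..1, 2 * sin (π * t) * sin ((((p + q - 2 * j : ℕ) : ℝ) + 1) * (π * t)) *
        exp (2 * c * cos (π * t))) := fun j => hasSum_bal (p + q - 2 * j) c
  refine ⟨?_, fun hc j _ => ⟨(hs j).summable, fun k => ?_⟩⟩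
  · simp_rw [u_mul, Finset.sum_mul]
    rw [intervalIntegral.integral_finsetSum
      (fun j _ => Continuous.intervalIntegrable (by fun_prop) _ _)]
    exact Finset.sum_congr rfl fun j _ => (hs j).tsum_eq.symm
  · exact mul_nonneg (div_nonneg (pow_nonneg hc _) (Nat.cast_nonneg _))
      (bal_nonneg (p + q - 2 * j) k)
end

section
/- For all p, q ∈ ℕ and every real β > 0, ∫₀¹ u_p(t) · u_q(t) · ( Σ_{l=0}^∞ exp(−l(l+1)β²/2) · (l+1) · sin((l+1)·π·t)/sin(π·t) ) dt = Σ_{j=0}^{min(p,q)} exp(−L(L+1)β²/2) · (L+1), where L = p+q−2j. (The sum over l defining the integrand, the heat-kernel weight of the Migdal action, converges for every t ∈ (0,1).) -/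
open MeasureTheory Real

noncomputable def wgt (β : ℝ) (l : ℕ) : ℝ :=
  Real.exp (-((l : ℝ) * ((l : ℝ) + 1)) * β ^ 2 / 2) * ((l : ℝ) + 1)

lemma wgt_nonneg (β : ℝ) (l : ℕ) : 0 ≤ wgt β l := by unfold wgt; positivity

lemma wgt_summable (β : ℝ) (hβ : 0 < β) : Summable (wgt β) := by
  set r := Real.exp (-(β ^ 2 / 2)) with hr
  have hr1 : ‖r‖ < 1 := by
    rw [Real.norm_of_nonneg (Real.exp_pos _).le, Real.exp_lt_one_iff]
    have : 0 < β ^ 2 := by positivity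
    linarith
  have h1 := summable_pow_mul_geometric_of_norm_lt_one 1 hr1
  have h0 := summable_pow_mul_geometric_of_norm_lt_one 0 hr1
  refine Summable.of_nonneg_of_le (wgt_nonneg β) (fun l => ?_) (h1.add h0)
  have : Real.exp (-((l : ℝ) * ((l : ℝ) + 1)) * β ^ 2 / 2) ≤ r ^ l := by
    rw [hr, ← Real.exp_nat_mul, Real.exp_le_exp]
    have : 0 ≤ (l : ℝ) * l * β ^ 2 := by positivity
    nlinarith
  calc wgt β l ≤ r ^ l * ((l : ℝ) + 1) := by
        unfold wgt; gcongr
    _ = _ := by ring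

lemma int_cos_s17 (k : ℤ) :
    ∫ t in (0:ℝ)..1, Real.cos ((k : ℝ) * π * t) = if k = 0 then 1 else 0 := by
  split_ifs with h
  · simp [h]
  · have hk : (k : ℝ) * π ≠ 0 := mul_ne_zero (by exact_mod_cast h) Real.pi_ne_zero
    rw [intervalIntegral.integral_comp_mul_left (fun x => Real.cos x) hk]
    simp

lemma int_sin (m l : ℕ) :
    ∫ t in (0:ℝ)..1, 2 * Real.sin (((m : ℝ) + 1) * π * t) * Real.sin (((l : ℝ) + 1) * π * t)
      = if l = m then 1 else 0 := by
  have h : ∀ t : ℝ, 2 * Real.sin (((m : ℝ) + 1) * π * t) * Real.sin (((l : ℝ) + 1) * π * t)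
      = Real.cos ((((l : ℤ) - m : ℤ) : ℝ) * π * t)
        - Real.cos ((((l : ℤ) + m + 2 : ℤ) : ℝ) * π * t) := by
    intro t
    have e1 : (((l : ℤ) - m : ℤ) : ℝ) * π * t
      = ((l : ℝ) + 1) * π * t - ((m : ℝ) + 1) * π * t := by push_cast; ring
    have e2 : (((l : ℤ) + m + 2 : ℤ) : ℝ) * π * t
      = ((l : ℝ) + 1) * π * t + ((m : ℝ) + 1) * π * t := by push_cast; ring
    rw [e1, e2, Real.cos_sub, Real.cos_add]; ring
  simp_rw [h]
  rw [intervalIntegral.integral_sub (Continuous.intervalIntegrable (by fun_prop) _ _)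
    (Continuous.intervalIntegrable (by fun_prop) _ _), int_cos_s17, int_cos_s17]
  have : ¬ ((l : ℤ) + m + 2 = 0) := by omega
  have h2 : ((l : ℤ) - m = 0) ↔ l = m := by omega
  simp [this, h2]

lemma cg_aux (p q : ℕ) (x : ℝ) (n : ℕ) (hn : 2 * n ≤ p + q + 2) :
    2 * Real.sin x * ∑ j ∈ Finset.range n, Real.sin ((((p + q - 2 * j : ℕ) : ℝ) + 1) * x)
      = Real.cos (((p : ℝ) + q + 2 - 2 * n) * x) - Real.cos (((p : ℝ) + q + 2) * x) := by
  induction n with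
  | zero => simp
  | succ n ih =>
    rw [Finset.sum_range_succ, mul_add, ih (by omega)]
    have hc : ((p + q - 2 * n : ℕ) : ℝ) = (p : ℝ) + q - 2 * n := by
      rw [Nat.cast_sub (by omega)]; push_cast; ring
    rw [hc]
    have e1 : ((p : ℝ) + q + 2 - 2 * n) * x = ((p : ℝ) + q - 2 * n + 1) * x + x := by ring
    have e2 : ((p : ℝ) + q + 2 - 2 * ((n + 1 : ℕ) : ℝ)) * x
      = ((p : ℝ) + q - 2 * n + 1) * x - x := by push_cast; ring
    rw [e1, e2, Real.cos_add _ x, Real.cos_sub]; ring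

lemma cg (p q : ℕ) (x : ℝ) :
    Real.sin (((p : ℝ) + 1) * x) * Real.sin (((q : ℝ) + 1) * x)
      = Real.sin x * ∑ j ∈ Finset.range (min p q + 1),
          Real.sin ((((p + q - 2 * j : ℕ) : ℝ) + 1) * x) := by
  have h := cg_aux p q x (min p q + 1) (by omega)
  have h1 : Real.cos (((p : ℝ) + q + 2 - 2 * ((min p q + 1 : ℕ) : ℝ)) * x)
      = Real.cos (((p : ℝ) + 1) * x - ((q : ℝ) + 1) * x) := by
    rcases le_total p q with hpq | hpq
    · rw [min_eq_left hpq, ← Real.cos_neg]; congr 1; push_cast; ring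
    · rw [min_eq_right hpq]; congr 1; push_cast; ring
  have h2 : ((p : ℝ) + q + 2) * x = ((p : ℝ) + 1) * x + ((q : ℝ) + 1) * x := by ring
  rw [h1, h2, Real.cos_sub, Real.cos_add] at h
  linarith

noncomputable def ser (β t : ℝ) : ℝ := ∑' l : ℕ, wgt β l * Real.sin (((l : ℝ) + 1) * π * t)

lemma wgt_bound (β t : ℝ) (l : ℕ) : ‖wgt β l * Real.sin (((l : ℝ) + 1) * π * t)‖ ≤ wgt β l := by
  rw [norm_mul, Real.norm_of_nonneg (wgt_nonneg β l)]
  exact mul_le_of_le_one_right (wgt_nonneg β l) (Real.abs_sin_le_one _)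

lemma ser_summable (β : ℝ) (hβ : 0 < β) (t : ℝ) :
    Summable fun l : ℕ => wgt β l * Real.sin (((l : ℝ) + 1) * π * t) :=
  Summable.of_norm_bounded (wgt_summable β hβ) (wgt_bound β t)

lemma ser_cont (β : ℝ) (hβ : 0 < β) : Continuous (ser β) :=
  continuous_tsum (fun l => by fun_prop) (wgt_summable β hβ) (fun l t => wgt_bound β t l)

lemma ser_coeff (β : ℝ) (hβ : 0 < β) (m : ℕ) :
    ∫ t in (0:ℝ)..1, 2 * Real.sin (((m : ℝ) + 1) * π * t) * ser β t = wgt β m := by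
  have H := intervalIntegral.hasSum_integral_of_dominated_convergence (μ := volume)
    (a := 0) (b := 1)
    (F := fun (l : ℕ) t => 2 * Real.sin (((m : ℝ) + 1) * π * t) *
      (wgt β l * Real.sin (((l : ℝ) + 1) * π * t)))
    (f := fun t => 2 * Real.sin (((m : ℝ) + 1) * π * t) * ser β t)
    (fun l _ => 2 * wgt β l)
    (fun l => Continuous.aestronglyMeasurable (by fun_prop))
    (fun l => Filter.Eventually.of_forall fun t _ => by
      rw [norm_mul]
      refine mul_le_mul ?_ (wgt_bound β t l) (norm_nonneg _) (by norm_num)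
      rw [norm_mul, Real.norm_of_nonneg (by norm_num : (0:ℝ) ≤ 2)]
      exact mul_le_of_le_one_right (by norm_num) (Real.abs_sin_le_one _))
    (Filter.Eventually.of_forall fun t _ => (wgt_summable β hβ).mul_left 2)
    (by simp)
    (Filter.Eventually.of_forall fun t _ => (ser_summable β hβ t).hasSum.mul_left _)
  have e : ∀ l : ℕ, (∫ t in (0:ℝ)..1, 2 * Real.sin (((m : ℝ) + 1) * π * t) *
      (wgt β l * Real.sin (((l : ℝ) + 1) * π * t))) = if l = m then wgt β m else 0 := by
    intro l
    have : ∀ t : ℝ, 2 * Real.sin (((m : ℝ) + 1) * π * t) *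
      (wgt β l * Real.sin (((l : ℝ) + 1) * π * t)) = wgt β l *
      (2 * Real.sin (((m : ℝ) + 1) * π * t) * Real.sin (((l : ℝ) + 1) * π * t)) := by
      intro t; ring
    simp_rw [this]
    rw [intervalIntegral.integral_const_mul, int_sin]
    split_ifs with h
    · rw [h, mul_one]
    · simp
  simp_rw [e] at H
  exact H.unique (hasSum_ite_eq m _)

/-- Edge contribution with the Migdal (heat-kernel) action:
`∫₀¹ u_p(t)·u_q(t)·(Σ_l e^{−l(l+1)β²/2}(l+1)·sin((l+1)πt)/sin(πt)) dt
  = Σ_{j=0}^{min(p,q)} e^{−L(L+1)β²/2}·(L+1)` with `L = p+q−2j`; moreover the series defining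
the integrand converges for every `t ∈ (0,1)`. -/
theorem migdal_edge_contribution (p q : ℕ) (β : ℝ) (hβ : 0 < β) :
    ((∫ t in (0:ℝ)..1, u p t * u q t *
          (∑' l : ℕ, Real.exp (-((l : ℝ) * ((l : ℝ) + 1)) * β ^ 2 / 2) * ((l : ℝ) + 1) *
            Real.sin (((l : ℝ) + 1) * π * t) / Real.sin (π * t)))
        = ∑ j ∈ Finset.range (min p q + 1),
            Real.exp (-(((p + q - 2 * j : ℕ) : ℝ) * (((p + q - 2 * j : ℕ) : ℝ) + 1)) * β ^ 2 / 2)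
              * (((p + q - 2 * j : ℕ) : ℝ) + 1)) ∧
    (∀ t ∈ Set.Ioo (0:ℝ) 1,
        Summable (fun l : ℕ => Real.exp (-((l : ℝ) * ((l : ℝ) + 1)) * β ^ 2 / 2) * ((l : ℝ) + 1) *
          Real.sin (((l : ℝ) + 1) * π * t) / Real.sin (π * t))) := by
  constructor
  · have key : ∀ t ∈ Set.Ioo (0:ℝ) 1, u p t * u q t *
          (∑' l : ℕ, Real.exp (-((l : ℝ) * ((l : ℝ) + 1)) * β ^ 2 / 2) * ((l : ℝ) + 1) *
            Real.sin (((l : ℝ) + 1) * π * t) / Real.sin (π * t))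
        = ∑ j ∈ Finset.range (min p q + 1),
          2 * Real.sin ((((p + q - 2 * j : ℕ) : ℝ) + 1) * π * t) * ser β t := by
      intro t ht
      have hs : Real.sin (π * t) ≠ 0 := by
        apply ne_of_gt
        apply Real.sin_pos_of_pos_of_lt_pi
        · exact mul_pos Real.pi_pos ht.1
        · exact mul_lt_of_lt_one_right Real.pi_pos ht.2
      rw [tsum_div_const]
      change _ * (ser β t / _) = _
      have h := cg p q (π * t)
      simp only [← mul_assoc] at h
      rw [← Finset.sum_mul, ← Finset.mul_sum]
      have h2 : Real.sqrt 2 * Real.sqrt 2 = 2 := Real.mul_self_sqrt (by norm_num)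
      calc u p t * u q t * (ser β t / Real.sin (π * t))
          = (Real.sqrt 2 * Real.sqrt 2) * (Real.sin (((p : ℝ) + 1) * π * t) *
            Real.sin (((q : ℝ) + 1) * π * t)) * (ser β t / Real.sin (π * t)) := by
            unfold u; ring
        _ = _ := by rw [h, h2]; field_simp
    rw [intervalIntegral.integral_of_le zero_le_one, integral_Ioc_eq_integral_Ioo,
      setIntegral_congr_fun measurableSet_Ioo key, ← integral_Ioc_eq_integral_Ioo,
      ← intervalIntegral.integral_of_le zero_le_one, intervalIntegral.integral_finsetSum]
    · exact Finset.sum_congr rfl fun j _ => ser_coeff β hβ _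
    · intro j _
      have := ser_cont β hβ
      exact Continuous.intervalIntegrable (by fun_prop) _ _
  · intro t _
    exact (ser_summable β hβ t).div_const _
end

section
/- Let f₁, f₂ : [0,1] → ℝ be continuous. For each integer k ≥ 1 set B_k(f₁,f₂) = Σ_{n=0}^∞ (n+1)^{−2k} · ( ∫₀¹ f₁(t)·2·sin²((n+1)·π·t) dt ) · ( ∫₀¹ f₂(t)·2·sin²((n+1)·π·t) dt ). Then lim_{k→∞} B_k(f₁,f₂)/ζ(2k) = ( ∫₀¹ f₁(t)·2·sin²(π·t) dt ) · ( ∫₀¹ f₂(t)·2·sin²(π·t) dt ). -/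
open MeasureTheory Real Filter

lemma aux_series (a : ℕ → ℝ) (M : ℝ) (hM : ∀ n, |a n| ≤ M) :
    Tendsto (fun k : ℕ => ∑' n : ℕ, ((1 : ℝ) / ((n : ℝ) + 1) ^ (2 * k)) * a n) atTop
      (nhds (a 0)) := by
  have h0 : a 0 = ∑' n : ℕ, (if n = 0 then a 0 else 0) := by simp
  rw [h0]
  apply tendsto_tsum_of_dominated_convergence
    (bound := fun n : ℕ => (1 / ((n : ℝ) + 1) ^ 2) * M)
  · apply Summable.mul_right
    have := (summable_nat_add_iff 1).2 (Real.summable_one_div_nat_pow.2 (by norm_num : 1 < 2))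
    simpa using this
  · intro n
    rcases n with _ | n
    · simp
    · have hx : (1 : ℝ) < ((n + 1 : ℕ) : ℝ) + 1 := by push_cast; linarith [n.cast_nonneg (α := ℝ)]
      have h1 : Tendsto (fun k : ℕ => ((1 / ((((n + 1 : ℕ) : ℝ) + 1) ^ 2)) ^ k)) atTop (nhds 0) := by
        apply tendsto_pow_atTop_nhds_zero_of_lt_one (by positivity)
        rw [div_lt_one (by positivity)]
        exact one_lt_pow₀ hx (by norm_num)
      have h2 := h1.mul_const (a (n + 1))
      simpa [pow_mul] using h2
  · filter_upwards [eventually_ge_atTop 1] with k hk n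
    rw [norm_mul, Real.norm_eq_abs, Real.norm_eq_abs, abs_of_nonneg (by positivity)]
    have hx : (1 : ℝ) ≤ (n : ℝ) + 1 := by linarith [n.cast_nonneg (α := ℝ)]
    have : ((n : ℝ) + 1) ^ 2 ≤ ((n : ℝ) + 1) ^ (2 * k) := pow_le_pow_right₀ hx (by omega)
    have hn := hM n
    gcongr

lemma aux_bound (f : ℝ → ℝ) (hf : ContinuousOn f (Set.Icc 0 1)) :
    ∃ C : ℝ, 0 ≤ C ∧ ∀ n : ℕ,
      |∫ t in (0:ℝ)..1, f t * (2 * Real.sin (((n : ℝ) + 1) * π * t) ^ 2)| ≤ C := by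
  obtain ⟨C, hC⟩ := isCompact_Icc.exists_bound_of_continuousOn hf
  have hC0 : 0 ≤ C := (norm_nonneg _).trans (hC 0 (by simp))
  refine ⟨C * 2, by positivity, fun n => ?_⟩
  have := intervalIntegral.norm_integral_le_of_norm_le_const (a := (0:ℝ)) (b := 1) (C := C * 2)
    (f := fun t => f t * (2 * Real.sin (((n : ℝ) + 1) * π * t) ^ 2)) (by
      intro t ht
      rw [Set.uIoc_of_le zero_le_one] at ht
      rw [norm_mul]
      have h1 := hC t ⟨ht.1.le, ht.2⟩
      have h2 : ‖2 * Real.sin (((n : ℝ) + 1) * π * t) ^ 2‖ ≤ 2 := by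
        rw [Real.norm_eq_abs, abs_of_nonneg (by positivity)]
        linarith [Real.sin_sq_le_one (((n : ℝ) + 1) * π * t)]
      gcongr)
  simpa using this

lemma aux_zeta : Tendsto (fun k : ℕ => riemannZeta (2 * k)) atTop (nhds 1) := by
  have h := aux_series (fun _ => 1) 1 (by simp)
  have h2 := (Complex.continuous_ofReal.tendsto _).comp h
  rw [Complex.ofReal_one] at h2
  refine h2.congr' ?_
  filter_upwards [eventually_ge_atTop 1] with k hk
  have hz := zeta_eq_tsum_one_div_nat_add_one_cpow (s := 2 * (k : ℂ)) (by
    have : (1 : ℝ) ≤ k := by exact_mod_cast hk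
    simp
    linarith)
  rw [hz]
  simp only [Function.comp, mul_one, Complex.ofReal_tsum]
  refine tsum_congr fun n => ?_
  have : (2 * (k : ℂ)) = ((2 * k : ℕ) : ℂ) := by push_cast; rfl
  rw [this, Complex.cpow_natCast]
  push_cast
  rfl

/-- Large-genus independence of two disjoint Wilson loops: with
`B_k(f₁,f₂) = Σₙ (n+1)^{−2k}·(∫₀¹ f₁(t)·2sin²((n+1)πt) dt)·(∫₀¹ f₂(t)·2sin²((n+1)πt) dt)`,
one has `lim_{k→∞} B_k(f₁,f₂)/ζ(2k) = (∫₀¹ f₁·2sin²(πt))·(∫₀¹ f₂·2sin²(πt))`. -/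
theorem two_wilson_loops_large_genus_limit (f₁ f₂ : ℝ → ℝ)
    (hf₁ : ContinuousOn f₁ (Set.Icc 0 1)) (hf₂ : ContinuousOn f₂ (Set.Icc 0 1)) :
    Tendsto (fun k : ℕ =>
        ((∑' n : ℕ, ((1 : ℝ) / ((n : ℝ) + 1) ^ (2 * k)) *
            ((∫ t in (0:ℝ)..1, f₁ t * (2 * Real.sin (((n : ℝ) + 1) * π * t) ^ 2)) *
             (∫ t in (0:ℝ)..1, f₂ t * (2 * Real.sin (((n : ℝ) + 1) * π * t) ^ 2))) : ℝ) : ℂ)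
          / riemannZeta (2 * k))
      atTop
      (nhds ((((∫ t in (0:ℝ)..1, f₁ t * (2 * Real.sin (π * t) ^ 2)) *
               (∫ t in (0:ℝ)..1, f₂ t * (2 * Real.sin (π * t) ^ 2)) : ℝ)) : ℂ)) := by
  obtain ⟨C₁, hC₁, h₁⟩ := aux_bound f₁ hf₁
  obtain ⟨C₂, hC₂, h₂⟩ := aux_bound f₂ hf₂
  have h := aux_series (fun n : ℕ =>
    (∫ t in (0:ℝ)..1, f₁ t * (2 * Real.sin (((n : ℝ) + 1) * π * t) ^ 2)) *
      (∫ t in (0:ℝ)..1, f₂ t * (2 * Real.sin (((n : ℝ) + 1) * π * t) ^ 2))) (C₁ * C₂) (by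
    intro n
    rw [abs_mul]
    exact mul_le_mul (h₁ n) (h₂ n) (abs_nonneg _) hC₁)
  have h3 := ((Complex.continuous_ofReal.tendsto _).comp h).div aux_zeta one_ne_zero
  simp only [Nat.cast_zero, zero_add, one_mul, div_one] at h3
  exact h3
end
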